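/- (Off-diagonal extrapolation from reverse Hölder weights into variable Lebesgue spaces.) Let $0<p<q<\infty$ and let $\mathcal{F}$ be a family of pairs of nonnegative measurable functions on $\mathbb{R}^n$. Suppose that for every weight $w$ with $w^p\in RH_{q/p}$ there is a constant $C=C(w)$ (depending only on the $RH_{q/p}$ constant of $w^p$) such that $\|f\|_{L^q(w^q)}\le C\|g\|_{L^p(w^p)}$ for all $(f,g)\in\mathcal{F}$ with $\|f\|_{L^q(w^q)}<\infty$. Then for every $p(\cdot)\in\mathcal{P}_0$ with $p<p_-\le p_+<\big(\tfrac1p-\tfrac1q\big)^{-1}$ and $p(\cdot)\in LH$, there is a constant $C'$ such that $\|f\|_{L^{q(\cdot)}}\le C'\|g\|_{L^{p(\cdot)}}$ for all $(f,g)\in\mathcal{F}$ with $\|f\|_{L^{q(\cdot)}}<\infty$, where $q(\cdot)$ is defined pointwise by $1/p(\cdot)-1/q(\cdot)=1/p-1/q$. -/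

import Mathlib

open MeasureTheory ENNReal Filter Topology

noncomputable section

/-- Euclidean space `ℝⁿ`. -/
abbrev Rn (n : ℕ) := EuclideanSpace ℝ (Fin n)

variable {n : ℕ}

/-- The closed axis-parallel cube with center `c` and half side length `r`. -/
def stdCube (c : Rn n) (r : ℝ) : Set (Rn n) := {y | ∀ i, |y i - c i| ≤ r}

/-- A cube with sides parallel to the coordinate axes. -/
def IsCube (Q : Set (Rn n)) : Prop := ∃ (c : Rn n) (r : ℝ), 0 < r ∧ Q = stdCube c r

/-- The average `⨍_Q f` of `f` over `Q`. -/
def cubeAvg (Q : Set (Rn n)) (f : Rn n → ℝ) : ℝ := (volume Q).toReal⁻¹ * ∫ y in Q, f y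

/-- The average `⨍_Q f` of a nonnegative function over `Q`, computed in `ℝ≥0∞`. -/
def cubeAvgE (Q : Set (Rn n)) (f : Rn n → ℝ) : ℝ≥0∞ :=
  (∫⁻ y in Q, ENNReal.ofReal (f y)) / volume Q

/-- The `L^q` average `(⨍_Q f^q)^{1/q}` of a nonnegative function over `Q`, in `ℝ≥0∞`. -/
def cubeAvgEq (Q : Set (Rn n)) (f : Rn n → ℝ) (q : ℝ) : ℝ≥0∞ :=
  ((∫⁻ y in Q, ENNReal.ofReal (f y) ^ q) / volume Q) ^ (1/q)

/-- A weight: a nonnegative locally integrable function, positive a.e. -/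
def IsWeight (w : Rn n → ℝ) : Prop :=
  LocallyIntegrable w volume ∧ (∀ x, 0 ≤ w x) ∧ ∀ᵐ x ∂(volume : Measure (Rn n)), 0 < w x

/-- The Muckenhoupt `A_1` condition with constant `C`. -/
def MuckA1With (w : Rn n → ℝ) (C : ℝ) : Prop :=
  ∀ Q : Set (Rn n), IsCube Q → ∀ᵐ x ∂(volume : Measure (Rn n)), x ∈ Q → cubeAvg Q w ≤ C * w x

/-- The Muckenhoupt `A_r` condition (`1 < r`) with constant `C`. -/
def MuckArWith (w : Rn n → ℝ) (r C : ℝ) : Prop :=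
  ∀ Q : Set (Rn n), IsCube Q →
    cubeAvg Q w * (cubeAvg Q fun x => w x ^ (1 - r / (r - 1))) ^ (r - 1) ≤ C

/-- The Muckenhoupt `A_r` condition, `r ≥ 1`. -/
def MuckA (w : Rn n → ℝ) (r : ℝ) : Prop :=
  (r = 1 ∧ ∃ C : ℝ, 0 < C ∧ MuckA1With w C) ∨
  (1 < r ∧ ∃ C : ℝ, 0 < C ∧ MuckArWith w r C)

/-- The class `A_∞ = ⋃_{r ≥ 1} A_r`. -/
def AInfty (w : Rn n → ℝ) : Prop := ∃ r : ℝ, 1 ≤ r ∧ MuckA w r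

/-- `r_w = inf { r ≥ 1 : w ∈ A_r }`. -/
def rIdx (w : Rn n → ℝ) : ℝ := sInf {r : ℝ | 1 ≤ r ∧ MuckA w r}

/-- The reverse Hölder condition `RH_s` with constant `C`. -/
def RHWith (w : Rn n → ℝ) (s C : ℝ) : Prop :=
  ∀ Q : Set (Rn n), IsCube Q → (cubeAvg Q fun x => w x ^ s) ^ (1/s) ≤ C * cubeAvg Q w

/-- The reverse Hölder class `RH_s`, `1 < s < ∞`. -/
def RH (w : Rn n → ℝ) (s : ℝ) : Prop := ∃ C : ℝ, 0 < C ∧ RHWith w s C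

/-- The reverse Hölder class `RH_∞`. -/
def RHInfty (w : Rn n → ℝ) : Prop :=
  ∃ C : ℝ, 0 < C ∧ ∀ Q : Set (Rn n), IsCube Q →
    ∀ᵐ x ∂(volume : Measure (Rn n)), x ∈ Q → w x ≤ C * cubeAvg Q w

/-- The weighted Lebesgue quasi-norm `‖f‖_{L^p(w)}`. -/
def weightedLp (p : ℝ) (w : Rn n → ℝ) (f : Rn n → ℝ) : ℝ≥0∞ :=
  (∫⁻ x, ENNReal.ofReal |f x| ^ p * ENNReal.ofReal (w x)) ^ (1/p)

/-- The weighted Lebesgue quasi-norm, for `ℝ≥0∞`-valued functions. -/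
def weightedLpE (p : ℝ) (w : Rn n → ℝ) (F : Rn n → ℝ≥0∞) : ℝ≥0∞ :=
  (∫⁻ x, F x ^ p * ENNReal.ofReal (w x)) ^ (1/p)

/-- The variable Lebesgue quasi-norm `‖F‖_{L^{p(·)}}`, for `ℝ≥0∞`-valued functions. -/
def varLpE (p : Rn n → ℝ) (F : Rn n → ℝ≥0∞) : ℝ≥0∞ :=
  sInf {lam : ℝ≥0∞ | 0 < lam ∧ ∫⁻ x, (F x / lam) ^ (p x) ≤ 1}

/-- The variable Lebesgue quasi-norm `‖f‖_{L^{p(·)}}`. -/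
def varLp (p : Rn n → ℝ) (f : Rn n → ℝ) : ℝ≥0∞ :=
  varLpE p fun x => ENNReal.ofReal |f x|

/-- An exponent function in `𝒫₀`: measurable with values in `(0,∞)`. -/
def ExponentP0 (p : Rn n → ℝ) : Prop := Measurable p ∧ ∀ x, 0 < p x

/-- Log-Hölder continuity, locally and at infinity. -/
def LogHolder (p : Rn n → ℝ) : Prop :=
  (∃ C₀ : ℝ, 0 < C₀ ∧ ∀ x y : Rn n, 0 < ‖x - y‖ → ‖x - y‖ < 1/2 →
      |p x - p y| ≤ C₀ / (-Real.log ‖x - y‖)) ∧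
  (∃ pinf Cinf : ℝ, 0 < Cinf ∧ ∀ x : Rn n, |p x - pinf| ≤ Cinf / Real.log (Real.exp 1 + ‖x‖))

/-- The partial derivative `∂_i f`. -/
def pderiv (i : Fin n) (f : Rn n → ℝ) : Rn n → ℝ :=
  fun x => fderiv ℝ f x (EuclideanSpace.single i 1)

/-- The higher-order partial derivative `∂^β f` for a multi-index `β`. -/
def multiDeriv (β : Fin n → ℕ) (f : Rn n → ℝ) : Rn n → ℝ :=
  (List.finRange n).foldr (fun i g => (pderiv i)^[β i] g) f

/-- An `(N,∞)` atom supported in the cube `Q`. -/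
def IsNAtom (N : ℕ) (a : Rn n → ℝ) (Q : Set (Rn n)) : Prop :=
  Measurable a ∧ (∀ x, |a x| ≤ 1) ∧ IsCube Q ∧ Function.support a ⊆ Q ∧
    ∀ β : Fin n → ℕ, (∑ i, β i) ≤ N → ∫ x, (∏ i, x i ^ β i) * a x = 0

/-- Membership in `𝒪_N`: a smooth compactly supported function with vanishing moments
up to order `N`. -/
def InON (N : ℕ) (f : Rn n → ℝ) : Prop :=
  ContDiff ℝ (⊤ : ℕ∞) f ∧ HasCompactSupport f ∧
    ∀ β : Fin n → ℕ, (∑ i, β i) ≤ N → ∫ x, (∏ i, x i ^ β i) * f x = 0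

/-- Tempered distributions on `ℝⁿ`. -/
abbrev TemperedDist (n : ℕ) := SchwartzMap (Rn n) ℝ →L[ℝ] ℝ

/-- The tempered distribution `u` is represented by the function `f`. -/
def Represents (u : TemperedDist n) (f : Rn n → ℝ) : Prop :=
  ∀ ψ : SchwartzMap (Rn n) ℝ, u ψ = ∫ x, f x * ψ x

/-- Membership in the class `𝒮_{N₀}`:
`∫ (1+|x|)^{N₀} (∑_{|β| ≤ N₀} |∂^β φ(x)|²) dx ≤ 1`. -/
def inSN (N₀ : ℕ) (φ : SchwartzMap (Rn n) ℝ) : Prop :=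
  ∫ x : Rn n, (1 + ‖x‖) ^ N₀ *
      ∑ β : Fin n → Fin (N₀ + 1),
        (if (∑ i, (β i : ℕ)) ≤ N₀ then
          (multiDeriv (fun i => (β i : ℕ)) (fun y => φ y) x) ^ 2 else 0) ≤ 1

/-- The grand maximal function `𝓜_{N₀} u (x) = sup_{φ ∈ 𝒮_{N₀}} sup_{t>0} |φ_t * u (x)|`,
where `φ_t * u (x) = u (y ↦ t^{-n} φ((x-y)/t))`. -/
def grandMax (N₀ : ℕ) (u : TemperedDist n) (x : Rn n) : ℝ≥0∞ :=
  sSup {r : ℝ≥0∞ | ∃ (φ ψ : SchwartzMap (Rn n) ℝ) (t : ℝ), 0 < t ∧ inSN N₀ φ ∧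
      (∀ y, ψ y = ((t ^ n)⁻¹ : ℝ) * φ (t⁻¹ • (x - y))) ∧ r = ENNReal.ofReal |u ψ|}

/-- The weighted Hardy space quasi-norm `‖u‖_{H^p(w)} = ‖𝓜_{N₀} u‖_{L^p(w)}`. -/
def hardyNorm (N₀ : ℕ) (p : ℝ) (w : Rn n → ℝ) (u : TemperedDist n) : ℝ≥0∞ :=
  weightedLpE p w (grandMax N₀ u)

/-- The variable Hardy space quasi-norm `‖u‖_{H^{p(·)}} = ‖𝓜_{N₀} u‖_{L^{p(·)}}`. -/
def hardyNormVar (N₀ : ℕ) (p : Rn n → ℝ) (u : TemperedDist n) : ℝ≥0∞ :=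
  varLpE p (grandMax N₀ u)

/-- The fractional maximal operator `M_γ` (the Hardy–Littlewood maximal operator if
`γ = 0`). -/
def fracMax (γ : ℝ) (f : Rn n → ℝ) (x : Rn n) : ℝ≥0∞ :=
  ⨆ (Q : Set (Rn n)) (_ : IsCube Q ∧ x ∈ Q),
    volume Q ^ (γ / (n : ℝ)) * ((∫⁻ y in Q, ENNReal.ofReal |f y|) / volume Q)

/-- `T` is bounded on (unweighted) `L²`. -/
def L2Bounded (T : (Rn n → ℝ) → Rn n → ℝ) : Prop :=
  ∃ A : ℝ, 0 < A ∧ ∀ f : Rn n → ℝ, Measurable f →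
    weightedLp 2 (fun _ => 1) (T f) ≤ ENNReal.ofReal A * weightedLp 2 (fun _ => 1) f

/-- The standard kernel size estimate `|K(x,y)| ≤ C|x-y|^{-n}`. -/
def CZKernelSize (K : Rn n → Rn n → ℝ) (C : ℝ) : Prop :=
  ∀ x y : Rn n, x ≠ y → |K x y| ≤ C * ‖x - y‖ ^ (-(n : ℝ))

/-- The standard kernel smoothness (Hölder) estimate of order `δ`. -/
def CZKernelSmooth (K : Rn n → Rn n → ℝ) (δ C : ℝ) : Prop :=
  ∀ x y h : Rn n, x ≠ y → ‖h‖ ≤ ‖x - y‖ / 2 →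
    |K x (y + h) - K x y| + |K (x + h) y - K x y| ≤ C * ‖h‖ ^ δ * ‖x - y‖ ^ (-(n : ℝ) - δ)

/-- A (non-convolution type) Calderón–Zygmund operator: bounded on `L²`, represented off
the support by a kernel `K` satisfying the standard estimates with exponent `δ`. -/
def CZOp (T : (Rn n → ℝ) → Rn n → ℝ) (K : Rn n → Rn n → ℝ) (δ : ℝ) : Prop :=
  L2Bounded T ∧ 0 < δ ∧ δ ≤ 1 ∧
  (∃ C : ℝ, 0 < C ∧ CZKernelSize K C ∧ CZKernelSmooth K δ C) ∧
  ∀ f : Rn n → ℝ, Measurable f → (∃ M : ℝ, ∀ x, |f x| ≤ M) → HasCompactSupport f →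
    ∀ x ∉ tsupport f, T f x = ∫ y, K x y * f y

/-- The higher-order smoothness condition on the kernel:
`|∂_y^β K(x,y+h) - ∂_y^β K(x,y)| ≤ C |h|^δ |x-y|^{-(n+m+δ)}` for all `|β| = m`. -/
def KernelHigherSmooth (K : Rn n → Rn n → ℝ) (δ : ℝ) (m : ℕ) (C : ℝ) : Prop :=
  (∀ x : Rn n, ContDiffOn ℝ m (fun z => K x z) {x}ᶜ) ∧
  ∀ β : Fin n → ℕ, (∑ i, β i) = m →
    ∀ x y h : Rn n, x ≠ y → ‖h‖ ≤ ‖x - y‖ / 2 →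
      |multiDeriv β (fun z => K x z) (y + h) - multiDeriv β (fun z => K x z) y|
        ≤ C * ‖h‖ ^ δ * ‖x - y‖ ^ (-((n : ℝ) + m + δ))

/-- `T` has `L` vanishing moments: `∫ x^β T a(x) dx = 0` for all `(L+1,∞)` atoms `a` and
all multi-indices `|β| ≤ L`.  (Vacuous if `L = -1`.) -/
def VanishingMoments (T : (Rn n → ℝ) → Rn n → ℝ) (L : ℤ) : Prop :=
  ∀ (a : Rn n → ℝ) (Q : Set (Rn n)), IsNAtom (L + 1).toNat a Q →
    ∀ β : Fin n → ℕ, (∑ i, (β i : ℤ)) ≤ L → ∫ x, (∏ i, x i ^ β i) * T a x = 0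

/-- Regularity of order `N+1` for a convolution kernel:
`|∂^α K(x)| ≤ A |x|^{-n-|α|}` for all `|α| ≤ N+1`. -/
def ConvKernelReg (K : Rn n → ℝ) (N : ℕ) : Prop :=
  ContDiffOn ℝ (N + 1 : ℕ) K {0}ᶜ ∧
  ∃ A : ℝ, 0 < A ∧ ∀ β : Fin n → ℕ, (∑ i, β i) ≤ N + 1 →
    ∀ x : Rn n, x ≠ 0 → |multiDeriv β K x| ≤ A * ‖x‖ ^ (-(n : ℝ) - (∑ i, β i))

/-- A Calderón–Zygmund singular integral operator of convolution type with regularity of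
order `N+1`: `T` is bounded on `L²` (equivalently, the kernel has bounded Fourier
transform), and `T f(x) = p.v. ∫ K(x-y) f(y) dy` for `f ∈ C_c^∞`. -/
def ConvCZO (T : (Rn n → ℝ) → Rn n → ℝ) (K : Rn n → ℝ) (N : ℕ) : Prop :=
  L2Bounded T ∧ ConvKernelReg K N ∧
  ∀ f : Rn n → ℝ, ContDiff ℝ (⊤ : ℕ∞) f → HasCompactSupport f → ∀ x : Rn n,
    Tendsto (fun ε : ℝ => ∫ y in {y : Rn n | ε < ‖x - y‖}, K (x - y) * f y)
      (𝓝[>] 0) (𝓝 (T f x))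

/-- The fractional integral operator `I_α`. -/
def fracInt (α : ℝ) (f : Rn n → ℝ) (x : Rn n) : ℝ :=
  ∫ y, f y * ‖x - y‖ ^ (α - (n : ℝ))

/-- The radial maximal function `M_φ g(x) = sup_{t>0} |φ_t * g(x)|` of a function `g`. -/
def MphiSup (φ : Rn n → ℝ) (g : Rn n → ℝ) (x : Rn n) : ℝ≥0∞ :=
  ⨆ (t : ℝ) (_ : 0 < t), ENNReal.ofReal |∫ y, (t ^ n)⁻¹ * φ (t⁻¹ • (x - y)) * g y|


/-- The uncentered Hardy–Littlewood maximal function over Euclidean balls. -/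
def maxFn (f : Rn n → ℝ≥0∞) (x : Rn n) : ℝ≥0∞ :=
  ⨆ (c : Rn n) (r : ℝ) (_ : x ∈ Metric.ball c r),
    (∫⁻ y in Metric.ball c r, f y) / volume (Metric.ball c r)

theorem le_maxFn (f : Rn n → ℝ≥0∞) {x c : Rn n} {r : ℝ} (hx : x ∈ Metric.ball c r) :
    (∫⁻ y in Metric.ball c r, f y) / volume (Metric.ball c r) ≤ maxFn f x :=
  le_iSup_of_le c (le_iSup_of_le r (le_iSup_of_le hx le_rfl))

theorem maxFn_le {f : Rn n → ℝ≥0∞} {x : Rn n} {a : ℝ≥0∞}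
    (h : ∀ (c : Rn n) (r : ℝ), 0 < r → x ∈ Metric.ball c r →
      (∫⁻ y in Metric.ball c r, f y) / volume (Metric.ball c r) ≤ a) : maxFn f x ≤ a :=
  iSup_le fun c => iSup_le fun r => iSup_le fun hx => h c r (Metric.pos_of_mem_ball hx) hx

theorem lt_maxFn_iff {f : Rn n → ℝ≥0∞} {x : Rn n} {a : ℝ≥0∞} :
    a < maxFn f x ↔ ∃ (c : Rn n) (r : ℝ), x ∈ Metric.ball c r ∧
      a < (∫⁻ y in Metric.ball c r, f y) / volume (Metric.ball c r) := by
  simp only [maxFn, lt_iSup_iff, exists_prop]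

theorem measurable_maxFn (f : Rn n → ℝ≥0∞) : Measurable (maxFn f) := by
  refine measurable_of_Ioi fun a => IsOpen.measurableSet ?_
  rw [isOpen_iff_forall_mem_open]
  intro x hx
  obtain ⟨c, r, hxr, h⟩ := lt_maxFn_iff.1 hx
  exact ⟨Metric.ball c r, fun y hy => lt_maxFn_iff.2 ⟨c, r, hy, h⟩, Metric.isOpen_ball, hxr⟩

theorem maxFn_mono {f g : Rn n → ℝ≥0∞} (h : ∀ x, f x ≤ g x) (x : Rn n) :
    maxFn f x ≤ maxFn g x :=
  maxFn_le fun _ _ _ hx =>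
    (ENNReal.div_le_div_right (lintegral_mono h) _).trans (le_maxFn g hx)

theorem maxFn_const_le (a : ℝ≥0∞) (x : Rn n) : maxFn (fun _ => a) x ≤ a :=
  maxFn_le fun c r hr _ => by
    rw [setLIntegral_const]
    exact (ENNReal.mul_div_cancel_right (Metric.measure_ball_pos volume c hr).ne'
      measure_ball_lt_top.ne).le

theorem maxFn_add_le {f g : Rn n → ℝ≥0∞} (hf : Measurable f) (x : Rn n) :
    maxFn (fun y => f y + g y) x ≤ maxFn f x + maxFn g x :=
  maxFn_le fun c r _ hx => by
    rw [lintegral_add_left hf, ENNReal.add_div]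
    exact add_le_add (le_maxFn f hx) (le_maxFn g hx)

theorem maxFn_const_mul_le {f : Rn n → ℝ≥0∞} (hf : Measurable f) (a : ℝ≥0∞) (x : Rn n) :
    maxFn (fun y => a * f y) x ≤ a * maxFn f x :=
  maxFn_le fun c r _ hx => by
    rw [lintegral_const_mul _ hf, mul_div_assoc]
    exact mul_le_mul_right (le_maxFn f hx) a

theorem maxFn_tsum_le {f : ℕ → Rn n → ℝ≥0∞} (hf : ∀ k, Measurable (f k)) (x : Rn n) :
    maxFn (fun y => ∑' k, f k y) x ≤ ∑' k, maxFn (f k) x :=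
  maxFn_le fun c r _ hx => by
    rw [lintegral_tsum fun k => (hf k).aemeasurable, div_eq_mul_inv, ← ENNReal.tsum_mul_right]
    exact ENNReal.tsum_le_tsum fun k => le_maxFn (f k) hx

/-- The maximal function is of weak type `(1,1)`. -/
theorem mul_volume_lt_maxFn_le (f : Rn n → ℝ≥0∞) (t : ℝ≥0∞) :
    t * volume {x | t < maxFn f x} ≤ 5 ^ n * ∫⁻ x, f x := by
  set A : ℕ → Set (Rn n × ℝ) := fun N => {a | 0 < a.2 ∧ a.2 ≤ N ∧
    t < (∫⁻ y in Metric.ball a.1 a.2, f y) / volume (Metric.ball a.1 a.2)} with hA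
  set E : ℕ → Set (Rn n) := fun N => ⋃ a ∈ A N, Metric.ball a.1 a.2 with hE
  have hmono : Monotone E := fun N N' h =>
    Set.biUnion_subset_biUnion_left fun a ha => ⟨ha.1, ha.2.1.trans (by exact_mod_cast h), ha.2.2⟩
  have hunion : {x | t < maxFn f x} = ⋃ N, E N := by
    ext x
    simp only [Set.mem_ofPred_eq, lt_maxFn_iff, hE, hA, Set.mem_iUnion, exists_prop, Prod.exists]
    constructor
    · rintro ⟨c, r, hx, h⟩
      obtain ⟨N, hN⟩ := exists_nat_ge r
      exact ⟨N, c, r, ⟨Metric.pos_of_mem_ball hx, hN, h⟩, hx⟩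
    · rintro ⟨N, c, r, ⟨_, _, h⟩, hx⟩
      exact ⟨c, r, hx, h⟩
  rw [hunion, hmono.measure_iUnion, ENNReal.mul_iSup]
  refine iSup_le fun N => ?_
  obtain ⟨u, huA, hdisj, hcov⟩ := Vitali.exists_disjoint_subfamily_covering_enlargement_ball
    (A N) Prod.fst Prod.snd N (fun a ha => ha.2.1) 5 (by norm_num)
  have hcount : u.Countable := hdisj.countable_of_isOpen (fun _ _ => Metric.isOpen_ball)
    fun a ha => Metric.nonempty_ball.2 (huA ha).1
  have hsub : E N ⊆ ⋃ a ∈ u, Metric.ball a.1 (5 * a.2) := by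
    refine Set.iUnion₂_subset fun a ha => ?_
    obtain ⟨b, hb, hab⟩ := hcov a ha
    exact hab.trans (Set.subset_biUnion_of_mem (u := fun a : Rn n × ℝ =>
      Metric.ball a.1 (5 * a.2)) hb)
  have : Countable u := hcount.to_subtype
  calc t * volume (E N) ≤ t * ∑' a : u, volume (Metric.ball a.1.1 (5 * a.1.2)) := by
        gcongr
        exact (measure_mono hsub).trans (measure_biUnion_le _ hcount _)
    _ = ∑' a : u, 5 ^ n * (t * volume (Metric.ball a.1.1 a.1.2)) := by
        rw [← ENNReal.tsum_mul_left]
        refine tsum_congr fun a => ?_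
        rw [Measure.addHaar_ball_mul_of_pos _ _ (by norm_num : (0 : ℝ) < 5),
          Measure.addHaar_ball_center volume a.1.1 a.1.2]
        have : ENNReal.ofReal (5 ^ Module.finrank ℝ (Rn n)) = 5 ^ n := by
          rw [finrank_euclideanSpace_fin, ENNReal.ofReal_pow (by norm_num)]
          norm_num
        rw [this]
        ring
    _ ≤ ∑' a : u, 5 ^ n * ∫⁻ y in Metric.ball a.1.1 a.1.2, f y := by
        refine ENNReal.tsum_le_tsum fun a => ?_
        gcongr
        exact ENNReal.mul_le_of_le_div (huA a.2).2.2.le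
    _ = 5 ^ n * ∫⁻ y in ⋃ a ∈ u, Metric.ball a.1 a.2, f y := by
        rw [ENNReal.tsum_mul_left, lintegral_biUnion hcount (fun _ _ => measurableSet_ball) hdisj]
    _ ≤ 5 ^ n * ∫⁻ x, f x := by
        gcongr
        exact Measure.restrict_le_self

theorem mul_volume_two_mul_lt_maxFn_le {f : Rn n → ℝ≥0∞} (hf : Measurable f) (t : ℝ≥0∞) :
    t * volume {x | 2 * t < maxFn f x} ≤ 5 ^ n * ∫⁻ x in {x | t < f x}, f x := by
  have hm : MeasurableSet {x | t < f x} := measurableSet_lt measurable_const hf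
  rw [← lintegral_indicator hm]
  refine le_trans (mul_le_mul_right (measure_mono fun x (h : 2 * t < maxFn f x) => ?_) t)
    (mul_volume_lt_maxFn_le _ t)
  change t < maxFn _ x
  by_contra hcon
  rw [not_lt] at hcon
  refine h.not_ge ?_
  calc maxFn f x ≤ maxFn (fun y => {x | t < f x}.indicator f y + t) x := by
        refine maxFn_mono (fun y => ?_) x
        by_cases hy : t < f y
        · rw [Set.indicator_of_mem (show y ∈ {x | t < f x} from hy)]
          exact le_self_add
        · exact (not_lt.1 hy).trans le_add_self
    _ ≤ maxFn ({x | t < f x}.indicator f) x + maxFn (fun _ => t) x :=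
        maxFn_add_le (hf.indicator hm) x
    _ ≤ t + t := add_le_add hcon (maxFn_const_le t x)
    _ = 2 * t := (two_mul t).symm

theorem setLIntegral_rpow_lt {s : ℝ} (hs : 0 < s) (a : ℝ≥0∞) :
    ∫⁻ t in Set.Ioi (0 : ℝ), {t : ℝ | ENNReal.ofReal t < a}.indicator
      (fun t => ENNReal.ofReal (t ^ (s - 1))) t = a ^ s * ENNReal.ofReal s⁻¹ := by
  have hfin : ∀ b : ℝ, 0 ≤ b → ∫⁻ t in Set.Ioi (0 : ℝ),
      {t : ℝ | ENNReal.ofReal t < ENNReal.ofReal b}.indicator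
      (fun t => ENNReal.ofReal (t ^ (s - 1))) t = ENNReal.ofReal b ^ s * ENNReal.ofReal s⁻¹ := by
    intro b hb
    rw [lintegral_indicator (measurableSet_lt ENNReal.measurable_ofReal measurable_const),
      Measure.restrict_restrict (measurableSet_lt ENNReal.measurable_ofReal measurable_const)]
    have hset : {t : ℝ | ENNReal.ofReal t < ENNReal.ofReal b} ∩ Set.Ioi 0 = Set.Ioo 0 b := by
      ext t
      simp only [Set.mem_inter_iff, Set.mem_ofPred_eq, Set.mem_Ioi, Set.mem_Ioo]
      constructor
      · rintro ⟨h, h0⟩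
        exact ⟨h0, (ENNReal.ofReal_lt_ofReal_iff_of_nonneg h0.le).1 h⟩
      · rintro ⟨h0, h⟩
        exact ⟨(ENNReal.ofReal_lt_ofReal_iff_of_nonneg h0.le).2 h, h0⟩
    rw [hset, restrict_Ioo_eq_restrict_Ioc, ← ofReal_integral_eq_lintegral_ofReal,
      ← intervalIntegral.integral_of_le hb, integral_rpow (Or.inl (by linarith))]
    · rw [sub_add_cancel, Real.zero_rpow hs.ne', sub_zero, div_eq_mul_inv,
        ENNReal.ofReal_mul (Real.rpow_nonneg hb s), ENNReal.ofReal_rpow_of_nonneg hb hs.le]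
    · exact (intervalIntegrable_iff_integrableOn_Ioc_of_le hb).1
        (intervalIntegral.intervalIntegrable_rpow' (by linarith))
    · filter_upwards [ae_restrict_mem measurableSet_Ioc] with t ht
      exact Real.rpow_nonneg ht.1.le _
  induction a with
  | coe a => simpa using hfin a a.2
  | top =>
    rw [ENNReal.top_rpow_of_pos hs, ENNReal.top_mul (by simpa using hs)]
    refine top_le_iff.1 (le_of_tendsto' (x := atTop) (f := fun N : ℕ =>
      ENNReal.ofReal N ^ s * ENNReal.ofReal s⁻¹) ?_ fun N => ?_)
    · have h1 : Tendsto (fun N : ℕ => ENNReal.ofReal N ^ s) atTop (𝓝 (⊤ ^ s)) := by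
        refine (ENNReal.continuous_rpow_const.tendsto ⊤).comp ?_
        simpa using ENNReal.tendsto_nat_nhds_top
      have h2 := ENNReal.Tendsto.mul_const (b := ENNReal.ofReal s⁻¹) h1
        (Or.inl (by simp [ENNReal.top_rpow_of_pos hs]))
      rwa [ENNReal.top_rpow_of_pos hs, ENNReal.top_mul (by simpa using hs)] at h2
    · rw [← hfin N N.cast_nonneg]
      refine lintegral_mono fun t => ?_
      refine Set.indicator_le_indicator_of_subset (fun t ht => ?_) (fun _ => zero_le) t
      exact ENNReal.ofReal_lt_top

/-- Boundedness of the maximal function on `L^s`, `1 < s < ∞`. -/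
theorem lintegral_maxFn_rpow_le {s : ℝ} (hs : 1 < s) : ∃ K : ℝ≥0∞, K ≠ ⊤ ∧
    ∀ f : Rn n → ℝ≥0∞, Measurable f → ∫⁻ x, maxFn f x ^ s ≤ K * ∫⁻ x, f x ^ s := by
  have hs0 : 0 < s := by linarith
  have hs1 : 0 < s - 1 := by linarith
  refine ⟨ENNReal.ofReal s * (2 * 5 ^ n * (2 ^ (s - 1) * ENNReal.ofReal (s - 1)⁻¹)),
    by finiteness, fun f hf => ?_⟩
  have hswap : ∀ {F : Rn n → ℝ≥0∞} (g : Rn n → ℝ≥0∞), Measurable F → Measurable g →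
      ∀ e : ℝ, ∫⁻ x, g x * ∫⁻ t in Set.Ioi (0 : ℝ), {t : ℝ | ENNReal.ofReal t < F x}.indicator
        (fun t => ENNReal.ofReal (t ^ e)) t =
      ∫⁻ t in Set.Ioi (0 : ℝ), ENNReal.ofReal (t ^ e) *
        ∫⁻ x in {x | ENNReal.ofReal t < F x}, g x := by
    intro F g hF hg e
    have hmt : ∀ x, Measurable ({t : ℝ | ENNReal.ofReal t < F x}.indicator
        (fun t => ENNReal.ofReal (t ^ e))) := fun x =>
      Measurable.indicator (by fun_prop)
        (measurableSet_lt ENNReal.measurable_ofReal measurable_const)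
    have hmx : ∀ t : ℝ, MeasurableSet {x | ENNReal.ofReal t < F x} := fun t =>
      measurableSet_lt measurable_const hF
    simp_rw [← lintegral_const_mul _ (hmt _)]
    rw [lintegral_lintegral_swap]
    · refine lintegral_congr fun t => ?_
      rw [← lintegral_indicator (hmx t), ← lintegral_const_mul _ (hg.indicator (hmx t))]
      refine lintegral_congr fun x => ?_
      by_cases h : ENNReal.ofReal t < F x
      · simp [Set.indicator, h, mul_comm]
      · simp [Set.indicator, h]
    · refine Measurable.aemeasurable ?_
      have : MeasurableSet {z : Rn n × ℝ | ENNReal.ofReal z.2 < F z.1} :=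
        measurableSet_lt (by fun_prop) (by fun_prop)
      have h2 : Measurable ({z : Rn n × ℝ | ENNReal.ofReal z.2 < F z.1}.indicator
        fun z => g z.1 * ENNReal.ofReal (z.2 ^ e)) := Measurable.indicator (by fun_prop) this
      convert h2 using 1
      ext ⟨x, t⟩
      by_cases h : ENNReal.ofReal t < F x <;> simp [Function.uncurry, Set.indicator, h]
  have h1 : ∫⁻ x, maxFn f x ^ s = ENNReal.ofReal s * ∫⁻ t in Set.Ioi (0 : ℝ),
      ENNReal.ofReal (t ^ (s - 1)) * volume {x | ENNReal.ofReal t < maxFn f x} := by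
    have := hswap (F := maxFn f) (fun _ => 1) (measurable_maxFn f) measurable_const (s - 1)
    simp_rw [setLIntegral_rpow_lt hs0, one_mul, setLIntegral_one] at this
    rw [← this, lintegral_mul_const _ ((measurable_maxFn f).pow_const s), mul_comm, mul_assoc,
      ← ENNReal.ofReal_mul (by positivity), inv_mul_cancel₀ hs0.ne', ENNReal.ofReal_one, mul_one]
  have h2 : ∀ t ∈ Set.Ioi (0 : ℝ),
      ENNReal.ofReal (t ^ (s - 1)) * volume {x | ENNReal.ofReal t < maxFn f x} ≤
      2 * 5 ^ n * (ENNReal.ofReal (t ^ (s - 1 - 1)) *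
        ∫⁻ x in {x | ENNReal.ofReal t < 2 * f x}, f x) := by
    intro t ht
    have ht : 0 < t := ht
    have hw := mul_volume_two_mul_lt_maxFn_le hf (ENNReal.ofReal (t / 2))
    have e1 : 2 * ENNReal.ofReal (t / 2) = ENNReal.ofReal t := by
      rw [← ENNReal.ofReal_ofNat 2, ← ENNReal.ofReal_mul (by norm_num)]
      congr 1
      ring
    have e2 : ∀ x, ENNReal.ofReal (t / 2) < f x ↔ ENNReal.ofReal t < 2 * f x := fun x => by
      rw [← e1, ENNReal.mul_lt_mul_iff_right (by norm_num) (by norm_num)]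
    simp_rw [e2, e1] at hw
    have e3 : ENNReal.ofReal (t ^ (s - 1)) =
        2 * ENNReal.ofReal (t ^ (s - 1 - 1)) * ENNReal.ofReal (t / 2) := by
      rw [mul_right_comm, e1, ← ENNReal.ofReal_mul ht.le]
      congr 1
      rw [Real.rpow_sub_one ht.ne' (s - 1)]
      field_simp
    rw [e3, mul_assoc]
    refine (mul_le_mul_right hw _).trans (le_of_eq ?_)
    ring
  calc ∫⁻ x, maxFn f x ^ s
      ≤ ENNReal.ofReal s * ∫⁻ t in Set.Ioi (0 : ℝ), 2 * 5 ^ n *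
        (ENNReal.ofReal (t ^ (s - 1 - 1)) * ∫⁻ x in {x | ENNReal.ofReal t < 2 * f x}, f x) := by
        rw [h1]
        gcongr ENNReal.ofReal s * ?_
        exact setLIntegral_mono' measurableSet_Ioi h2
    _ = ENNReal.ofReal s * (2 * 5 ^ n * ∫⁻ x, f x * ((2 * f x) ^ (s - 1) *
        ENNReal.ofReal (s - 1)⁻¹)) := by
        rw [lintegral_const_mul' _ _ (by finiteness), ← hswap f (hf.const_mul 2) hf]
        simp_rw [setLIntegral_rpow_lt hs1]
    _ = _ := by
        have : ∀ x, f x * ((2 * f x) ^ (s - 1) * ENNReal.ofReal (s - 1)⁻¹) =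
            2 ^ (s - 1) * ENNReal.ofReal (s - 1)⁻¹ * f x ^ s := fun x => by
          rw [ENNReal.mul_rpow_of_nonneg _ _ hs1.le]
          conv_rhs => rw [show s = 1 + (s - 1) by ring,
            ENNReal.rpow_add_of_nonneg _ _ zero_le_one hs1.le, ENNReal.rpow_one]
          rw [show 1 + (s - 1) - 1 = s - 1 by ring]
          ring
        simp_rw [this]
        rw [lintegral_const_mul' _ _ (by finiteness)]
        ring

theorem average_rpow_le {B : Set (Rn n)} (hB0 : volume B ≠ 0) (hB : volume B ≠ ⊤)
    {f : Rn n → ℝ≥0∞} (hf : Measurable f) {v : ℝ} (hv : 1 ≤ v) :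
    ((∫⁻ y in B, f y) / volume B) ^ v ≤ (∫⁻ y in B, f y ^ v) / volume B := by
  have hv0 : 0 < v := by linarith
  set ν : Measure (Rn n) := (volume B)⁻¹ • volume.restrict B with hν
  have : IsProbabilityMeasure ν := ⟨by
    simp [hν, ENNReal.inv_mul_cancel hB0 hB]⟩
  have h := eLpNorm'_le_eLpNorm'_of_exponent_le one_pos hv ν hf.aestronglyMeasurable
  simp only [eLpNorm', enorm_eq_self, ENNReal.rpow_one, div_one, one_div, hν,
    lintegral_smul_measure, smul_eq_mul] at h
  rw [ENNReal.le_rpow_inv_iff hv0] at h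
  simpa only [div_eq_mul_inv, mul_comm] using h

theorem average_rpow_le_of_exponent_le {c : Rn n} {ρ : ℝ} (hρ : 0 < ρ) {u : Rn n → ℝ}
    {f : Rn n → ℝ≥0∞} (hf : Measurable f) (hf1 : ∀ x, f x = 0 ∨ 1 ≤ f x)
    (hint : ∫⁻ x, f x ^ u x ≤ 1) {x : Rn n} {v : ℝ} (hv : 1 ≤ v) (hvx : v ≤ u x)
    (hvB : ∀ y ∈ Metric.ball c ρ, v ≤ u y) {D K : ℝ≥0∞} (hD1 : 1 ≤ D)
    (hD : (volume (Metric.ball c ρ))⁻¹ ≤ D) (hK : D ^ (u x - v) ≤ K) :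
    ((∫⁻ y in Metric.ball c ρ, f y) / volume (Metric.ball c ρ)) ^ u x ≤
      K * ((∫⁻ y in Metric.ball c ρ, f y ^ u y) / volume (Metric.ball c ρ)) := by
  have hv0 : 0 < v := by linarith
  set B := Metric.ball c ρ
  set A := (∫⁻ y in B, f y ^ u y) / volume B
  have h1 : ((∫⁻ y in B, f y) / volume B) ^ v ≤ A := by
    refine (average_rpow_le (Metric.measure_ball_pos volume c hρ).ne' measure_ball_lt_top.ne
      hf hv).trans (ENNReal.div_le_div_right (setLIntegral_mono' measurableSet_ball ?_) _)
    intro y hy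
    rcases hf1 y with h | h
    · rw [h, ENNReal.zero_rpow_of_pos hv0]
      exact zero_le
    · exact ENNReal.rpow_le_rpow_of_exponent_le h (hvB y hy)
  have h2 : A ≤ D := by
    refine le_trans ?_ hD
    rw [← one_div]
    exact ENNReal.div_le_div_right ((setLIntegral_le_lintegral _ _).trans hint) _
  have h3 : 0 ≤ (u x - v) / v := div_nonneg (by linarith) hv0.le
  have h4 : (u x - v) / v ≤ u x - v := div_le_self (by linarith) hv
  calc ((∫⁻ y in B, f y) / volume B) ^ u x
      = (((∫⁻ y in B, f y) / volume B) ^ v) ^ (u x / v) := by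
        rw [← ENNReal.rpow_mul, mul_div_cancel₀ _ hv0.ne']
    _ ≤ A ^ (u x / v) := ENNReal.rpow_le_rpow h1 (div_nonneg (by linarith) hv0.le)
    _ = A ^ ((u x - v) / v) * A := by
        rw [show u x / v = (u x - v) / v + 1 by field_simp; ring,
          ENNReal.rpow_add_of_nonneg _ _ h3 zero_le_one, ENNReal.rpow_one]
    _ ≤ K * A := by
        gcongr
        exact (ENNReal.rpow_le_rpow h2 h3).trans
          ((ENNReal.rpow_le_rpow_of_exponent_le hD1 h4).trans hK)

theorem exists_average_rpow_le {u : Rn n → ℝ} {U C₀ : ℝ} (hu1 : ∀ x, 1 ≤ u x)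
    (huU : ∀ x, u x ≤ U) (hC₀ : 0 < C₀)
    (hu : ∀ x y : Rn n, 0 < ‖x - y‖ → ‖x - y‖ < 1 / 2 →
      |u x - u y| ≤ C₀ / (-Real.log ‖x - y‖)) :
    ∃ K : ℝ≥0∞, K ≠ ⊤ ∧ ∀ f : Rn n → ℝ≥0∞, Measurable f → (∀ x, f x = 0 ∨ 1 ≤ f x) →
      ∫⁻ x, f x ^ u x ≤ 1 → ∀ (c : Rn n) (ρ : ℝ), 0 < ρ → ∀ x ∈ Metric.ball c ρ,
      ((∫⁻ y in Metric.ball c ρ, f y) / volume (Metric.ball c ρ)) ^ u x ≤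
        K * ((∫⁻ y in Metric.ball c ρ, f y ^ u y) / volume (Metric.ball c ρ)) := by
  set ω : ℝ≥0∞ := volume (Metric.ball (0 : Rn n) 1)
  have hω0 : ω ≠ 0 := (Metric.measure_ball_pos volume (0 : Rn n) one_pos).ne'
  set L : ℝ≥0∞ := max 1 ω⁻¹
  have hL1 : 1 ≤ L := le_max_left _ _
  have hLtop : L ≠ ⊤ := by
    simp only [L, ne_eq, max_eq_top, ENNReal.one_ne_top, ENNReal.inv_eq_top, hω0, or_self,
      not_false_eq_true]
  have hU : 1 ≤ U := (hu1 0).trans (huU 0)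
  have hlog2 : 0 < Real.log 2 := Real.log_pos (by norm_num)
  have hvol : ∀ (c : Rn n) (ρ : ℝ), 0 < ρ →
      (volume (Metric.ball c ρ))⁻¹ ≤ L * ENNReal.ofReal (ρ⁻¹ ^ n) := by
    intro c ρ hρ
    rw [Measure.addHaar_ball_of_pos _ _ hρ, finrank_euclideanSpace_fin,
      ENNReal.mul_inv (Or.inr measure_ball_lt_top.ne) (Or.inl ENNReal.ofReal_ne_top), mul_comm,
      inv_pow, ENNReal.ofReal_inv_of_pos (by positivity)]
    gcongr
    exact le_max_right _ _
  refine ⟨max ((L * ENNReal.ofReal (4 ^ n)) ^ U)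
    (L ^ (C₀ / Real.log 2) * ENNReal.ofReal (Real.exp (2 * n * C₀))), ?_, ?_⟩
  · have h1 : L * ENNReal.ofReal (4 ^ n) ≠ ⊤ := by finiteness
    have h2 := ENNReal.rpow_ne_top_of_nonneg (zero_le_one.trans hU) h1
    have h3 := ENNReal.rpow_ne_top_of_nonneg (div_pos hC₀ hlog2).le hLtop
    have h4 := ENNReal.mul_ne_top h3 (ENNReal.ofReal_ne_top (r := Real.exp (2 * n * C₀)))
    exact (max_lt h2.lt_top h4.lt_top).ne
  intro f hf hf1 hint c ρ hρ x hx
  rcases le_or_gt (1 / 4) ρ with hρ4 | hρ4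
  · refine average_rpow_le_of_exponent_le hρ hf hf1 hint le_rfl (hu1 x) (fun y _ => hu1 y)
      (D := L * ENNReal.ofReal (4 ^ n)) ?_ ?_ ?_
    · refine one_le_mul hL1 ?_
      rw [ENNReal.one_le_ofReal]
      exact one_le_pow₀ (by norm_num)
    · refine (hvol c ρ hρ).trans ?_
      gcongr
      rw [inv_le_comm₀ hρ (by norm_num)]
      linarith
    · refine le_trans (ENNReal.rpow_le_rpow_of_exponent_le ?_ ?_) (le_max_left _ _)
      · refine one_le_mul hL1 ?_
        rw [ENNReal.one_le_ofReal]
        exact one_le_pow₀ (by norm_num)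
      · linarith [huU x]
  · set l := -Real.log (2 * ρ) with hl
    have hl2 : Real.log 2 ≤ l := by
      rw [hl, ← Real.log_inv]
      refine Real.log_le_log (by norm_num) ?_
      rw [le_inv_comm₀ (by norm_num) (by linarith)]
      linarith
    have hl0 : 0 < l := hlog2.trans_le hl2
    have hδ : ∀ y ∈ Metric.ball c ρ, |u x - u y| ≤ C₀ / l := by
      intro y hy
      rcases eq_or_ne x y with rfl | hxy
      · simpa using (div_pos hC₀ hl0).le
      have hd0 : 0 < ‖x - y‖ := norm_pos_iff.2 (sub_ne_zero.2 hxy)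
      have hd : ‖x - y‖ < 2 * ρ := by
        rw [← dist_eq_norm]
        rw [Metric.mem_ball] at hx hy
        linarith [dist_triangle_right x y c]
      refine (hu x y hd0 (by linarith)).trans ?_
      gcongr
      exact neg_le_neg (Real.log_le_log hd0 hd.le)
    have hρn : 1 ≤ ρ⁻¹ := (one_le_inv₀ hρ).2 (by linarith)
    refine average_rpow_le_of_exponent_le hρ hf hf1 hint (v := max 1 (u x - C₀ / l))
      (le_max_left _ _) (max_le (hu1 x) (by linarith [div_pos hC₀ hl0]))
      (fun y hy => max_le (hu1 y) (by linarith [(abs_le.1 (hδ y hy)).2]))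
      (D := L * ENNReal.ofReal (ρ⁻¹ ^ n)) ?_ (hvol c ρ hρ) ?_
    · refine one_le_mul hL1 ?_
      rw [ENNReal.one_le_ofReal]
      exact one_le_pow₀ hρn
    · have hD1 : 1 ≤ L * ENNReal.ofReal (ρ⁻¹ ^ n) := by
        refine one_le_mul hL1 ?_
        rw [ENNReal.one_le_ofReal]
        exact one_le_pow₀ hρn
      refine le_trans (ENNReal.rpow_le_rpow_of_exponent_le hD1
        (show _ ≤ C₀ / l by linarith [le_max_right 1 (u x - C₀ / l)])) ?_
      refine le_trans ?_ (le_max_right _ _)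
      rw [ENNReal.mul_rpow_of_nonneg _ _ (div_pos hC₀ hl0).le]
      refine mul_le_mul' (ENNReal.rpow_le_rpow_of_exponent_le hL1 (by gcongr)) ?_
      rw [ENNReal.ofReal_rpow_of_pos (by positivity)]
      refine ENNReal.ofReal_le_ofReal ?_
      rw [Real.rpow_def_of_pos (by positivity), Real.log_pow, Real.log_inv]
      refine Real.exp_le_exp.2 ?_
      have h1 : -Real.log ρ ≤ 2 * l := by
        rw [Real.log_mul (by norm_num) hρ.ne'] at hl
        linarith
      calc n * -Real.log ρ * (C₀ / l) ≤ n * (2 * l) * (C₀ / l) := by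
            gcongr
        _ = 2 * n * C₀ := by field_simp

theorem exists_rpow_le_of_abs_sub_le {x : Rn n} {F : ℝ≥0∞} (hF : F ≤ 1) {b c C : ℝ}
    (hb : 1 ≤ b) (hC : |b - c| ≤ C / Real.log (Real.exp 1 + ‖x‖)) :
    F ^ b ≤ ENNReal.ofReal (Real.exp ((n + 1) * C)) * F ^ c +
      ENNReal.ofReal ((1 + ‖x‖) ^ (-(n + 1 : ℝ))) := by
  have hx0 := norm_nonneg x
  have he1 : 1 ≤ Real.exp 1 := Real.one_le_exp zero_le_one
  have hlog : 0 < Real.log (Real.exp 1 + ‖x‖) := Real.log_pos (by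
    linarith [Real.exp_one_gt_two])
  have hC0 : 0 ≤ C := by
    have := (abs_nonneg _).trans hC
    by_contra hneg
    exact absurd this (not_le.2 (div_neg_of_neg_of_pos (not_le.1 hneg) hlog))
  set E : ℝ := (1 + ‖x‖) ^ (-(n + 1 : ℝ)) with hE
  have hE0 : 0 < E := by positivity
  rcases lt_or_ge F (ENNReal.ofReal E) with h | h
  · exact (ENNReal.rpow_le_self_of_le_one hF hb).trans (h.le.trans le_add_self)
  refine le_trans ?_ le_self_add
  have hF0 : F ≠ 0 := ((ENNReal.ofReal_pos.2 hE0).trans_le h).ne'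
  have hFt : F ≠ ⊤ := (hF.trans_lt ENNReal.one_lt_top).ne
  rcases le_total c b with hcb | hcb
  · refine (ENNReal.rpow_le_rpow_of_exponent_ge hF hcb).trans (le_mul_of_one_le_left' ?_)
    rw [ENNReal.one_le_ofReal]
    exact Real.one_le_exp (by positivity)
  · rw [show b = -(c - b) + c by ring, ENNReal.rpow_add _ _ hF0 hFt]
    gcongr
    rw [ENNReal.rpow_neg, ← ENNReal.inv_rpow]
    have hinv : F⁻¹ ≤ ENNReal.ofReal ((1 + ‖x‖) ^ (n + 1 : ℝ)) := by
      rw [hE, Real.rpow_neg (by positivity), ENNReal.ofReal_inv_of_pos (by positivity)] at h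
      exact ENNReal.inv_le_iff_inv_le.1 h
    refine (ENNReal.rpow_le_rpow hinv (by linarith)).trans ?_
    rw [ENNReal.ofReal_rpow_of_pos (by positivity)]
    refine ENNReal.ofReal_le_ofReal ?_
    rw [← Real.rpow_mul (by positivity), Real.rpow_def_of_pos (by positivity)]
    refine Real.exp_le_exp.2 ?_
    have h1 : Real.log (1 + ‖x‖) ≤ Real.log (Real.exp 1 + ‖x‖) :=
      Real.log_le_log (by positivity) (by linarith)
    have h2 : c - b ≤ C / Real.log (Real.exp 1 + ‖x‖) :=
      (by linarith [neg_abs_le (b - c)] : c - b ≤ |b - c|).trans hC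
    calc Real.log (1 + ‖x‖) * ((n + 1) * (c - b))
        ≤ Real.log (Real.exp 1 + ‖x‖) * ((n + 1) * (C / Real.log (Real.exp 1 + ‖x‖))) := by
          gcongr
      _ = (n + 1) * C := by field_simp

theorem lintegral_one_add_norm_lt_top :
    ∫⁻ x : Rn n, ENNReal.ofReal ((1 + ‖x‖) ^ (-(n + 1 : ℝ))) < ⊤ :=
  finite_integral_one_add_norm (by simp)

theorem LogHolder.exists_limit {r : Rn n → ℝ} (hr : LogHolder r) {a : ℝ} (ha : ∀ x, a ≤ r x) :
    ∃ s C : ℝ, a ≤ s ∧ ∀ x, |r x - s| ≤ C / Real.log (Real.exp 1 + ‖x‖) := by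
  obtain ⟨-, s, C, -, h⟩ := hr
  refine ⟨max s a, C, le_max_right _ _, fun x => le_trans ?_ (h x)⟩
  rcases le_total a s with has | has
  · rw [max_eq_left has]
  · rw [max_eq_right has, abs_of_nonneg (by linarith [ha x]), abs_of_nonneg (by linarith [ha x])]
    linarith

theorem exists_modular_maxFn_large_le {r : Rn n → ℝ} {a R : ℝ} (ha : 1 < a)
    (har : ∀ x, a ≤ r x) (hrR : ∀ x, r x ≤ R) (hrm : Measurable r) (hr : LogHolder r) :
    ∃ K : ℝ≥0∞, K ≠ ⊤ ∧ ∀ f : Rn n → ℝ≥0∞, Measurable f → (∀ x, f x = 0 ∨ 1 ≤ f x) →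
      ∫⁻ x, f x ^ r x ≤ 1 → ∫⁻ x, maxFn f x ^ r x ≤ K := by
  have ha0 : 0 < a := by linarith
  obtain ⟨⟨C₀, hC₀, hloc⟩, -⟩ := hr
  obtain ⟨K₁, hK₁, h₁⟩ := exists_average_rpow_le (u := fun x => r x / a) (U := R / a)
    (C₀ := C₀ / a) (fun x => (one_le_div ha0).2 (har x))
    (fun x => by gcongr; exact hrR x) (by positivity) (fun x y h h' => by
      rw [← sub_div, abs_div, abs_of_pos ha0, div_right_comm]
      gcongr
      exact hloc x y h h')
  obtain ⟨K₂, hK₂, h₂⟩ := lintegral_maxFn_rpow_le (n := n) ha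
  refine ⟨K₁ ^ a * K₂, ENNReal.mul_ne_top (ENNReal.rpow_ne_top_of_nonneg ha0.le hK₁) hK₂,
    fun f hf hf1 hint => ?_⟩
  have hu0 : ∀ x, 0 < r x / a := fun x => div_pos (by linarith [har x]) ha0
  have hfu : Measurable fun x => f x ^ (r x / a) := by fun_prop
  have hle : ∫⁻ x, f x ^ (r x / a) ≤ 1 := by
    refine (lintegral_mono fun x => ?_).trans hint
    rcases hf1 x with h | h
    · rw [h, ENNReal.zero_rpow_of_pos (hu0 x)]
      exact zero_le
    · exact ENNReal.rpow_le_rpow_of_exponent_le h (div_le_self (by linarith [har x]) ha.le)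
  have hpt : ∀ x, maxFn f x ^ (r x / a) ≤ K₁ * maxFn (fun x => f x ^ (r x / a)) x := by
    intro x
    rw [← ENNReal.le_rpow_inv_iff (hu0 x)]
    refine maxFn_le fun c ρ hρ hx => ?_
    rw [ENNReal.le_rpow_inv_iff (hu0 x)]
    exact (h₁ f hf hf1 hle c ρ hρ x hx).trans (mul_le_mul_right (le_maxFn _ hx) _)
  have hra : ∀ (b : ℝ≥0∞) x, b ^ r x = (b ^ (r x / a)) ^ a := fun b x => by
    rw [← ENNReal.rpow_mul, div_mul_cancel₀ _ ha0.ne']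
  calc ∫⁻ x, maxFn f x ^ r x
      ≤ ∫⁻ x, K₁ ^ a * maxFn (fun x => f x ^ (r x / a)) x ^ a := by
        refine lintegral_mono fun x => ?_
        rw [hra, ← ENNReal.mul_rpow_of_nonneg _ _ ha0.le]
        exact ENNReal.rpow_le_rpow (hpt x) ha0.le
    _ = K₁ ^ a * ∫⁻ x, maxFn (fun x => f x ^ (r x / a)) x ^ a :=
        lintegral_const_mul _ ((measurable_maxFn _).pow_const a)
    _ ≤ K₁ ^ a * (K₂ * ∫⁻ x, (f x ^ (r x / a)) ^ a) := by
        gcongr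
        exact h₂ _ hfu
    _ ≤ K₁ ^ a * K₂ := by
        simp_rw [← hra]
        gcongr
        exact mul_le_of_le_one_right' hint

theorem exists_modular_maxFn_small_le {r : Rn n → ℝ} {a : ℝ} (ha : 1 < a)
    (har : ∀ x, a ≤ r x) (hr : LogHolder r) :
    ∃ K : ℝ≥0∞, K ≠ ⊤ ∧ ∀ f : Rn n → ℝ≥0∞, Measurable f → (∀ x, f x ≤ 1) →
      ∫⁻ x, f x ^ r x ≤ 1 → ∫⁻ x, maxFn f x ^ r x ≤ K := by
  obtain ⟨s, C, has, hC⟩ := hr.exists_limit har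
  obtain ⟨K, hK, hKM⟩ := lintegral_maxFn_rpow_le (n := n) (ha.trans_le has)
  set e := ENNReal.ofReal (Real.exp ((n + 1) * C))
  set I := ∫⁻ x : Rn n, ENNReal.ofReal ((1 + ‖x‖) ^ (-(n + 1 : ℝ)))
  have hI : I ≠ ⊤ := lintegral_one_add_norm_lt_top.ne
  refine ⟨e * (K * (e * 1 + I)) + I, by finiteness, fun f hf hf1 hint => ?_⟩
  have hM1 : ∀ x, maxFn f x ≤ 1 := fun x => (maxFn_mono hf1 x).trans (maxFn_const_le 1 x)
  have hmI : Measurable fun x : Rn n => ENNReal.ofReal ((1 + ‖x‖) ^ (-(n + 1 : ℝ))) := by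
    fun_prop
  have hfs : ∫⁻ x, f x ^ s ≤ e * 1 + I := by
    refine (lintegral_mono fun x => exists_rpow_le_of_abs_sub_le (hf1 x)
      (ha.le.trans has) (by rw [abs_sub_comm]; exact hC x)).trans ?_
    rw [lintegral_add_right _ hmI, lintegral_const_mul' _ _ ENNReal.ofReal_ne_top]
    gcongr
  refine (lintegral_mono fun x => exists_rpow_le_of_abs_sub_le (hM1 x)
    (ha.le.trans (har x)) (hC x)).trans ?_
  rw [lintegral_add_right _ hmI, lintegral_const_mul' _ _ ENNReal.ofReal_ne_top]
  gcongr
  exact (hKM f hf).trans (by gcongr)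

/-- Boundedness of the maximal function on `L^{r(·)}`, for a log-Hölder continuous exponent
bounded away from `1` and `∞`, in modular form. -/
theorem exists_modular_maxFn_le {r : Rn n → ℝ} {a R : ℝ} (ha : 1 < a)
    (har : ∀ x, a ≤ r x) (hrR : ∀ x, r x ≤ R) (hrm : Measurable r) (hr : LogHolder r) :
    ∃ K : ℝ≥0∞, K ≠ ⊤ ∧ ∀ f : Rn n → ℝ≥0∞, Measurable f →
      ∫⁻ x, f x ^ r x ≤ 1 → ∫⁻ x, maxFn f x ^ r x ≤ K := by
  obtain ⟨K₁, hK₁, h₁⟩ := exists_modular_maxFn_large_le ha har hrR hrm hr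
  obtain ⟨K₂, hK₂, h₂⟩ := exists_modular_maxFn_small_le ha har hr
  have hR0 : 0 ≤ R := by linarith [har 0, hrR 0]
  refine ⟨2 ^ R * (K₁ + K₂), by finiteness, fun f hf hint => ?_⟩
  have hs : MeasurableSet {x | 1 < f x} := measurableSet_lt measurable_const hf
  set f₁ : Rn n → ℝ≥0∞ := {x | 1 < f x}.indicator f with hf₁
  set f₂ : Rn n → ℝ≥0∞ := {x | 1 < f x}ᶜ.indicator f with hf₂
  have hm₁ : Measurable f₁ := hf.indicator hs
  have hm₂ : Measurable f₂ := hf.indicator hs.compl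
  have hle : ∀ {g : Rn n → ℝ≥0∞}, (∀ x, g x ≤ f x) → ∫⁻ x, g x ^ r x ≤ 1 := fun hg =>
    (lintegral_mono fun x => ENNReal.rpow_le_rpow (hg x) (by linarith [har x])).trans hint
  have hb₁ := h₁ f₁ hm₁ (fun x => by
    by_cases h : 1 < f x
    · exact Or.inr (by simpa [hf₁, h] using h.le)
    · exact Or.inl (by simp [hf₁, h])) (hle fun x => Set.indicator_le_self _ _ x)
  have hb₂ := h₂ f₂ hm₂ (fun x => by
    by_cases h : 1 < f x
    · simp [hf₂, h]
    · simpa [hf₂, h] using not_lt.1 h) (hle fun x => Set.indicator_le_self _ _ x)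
  calc ∫⁻ x, maxFn f x ^ r x
      ≤ ∫⁻ x, 2 ^ R * (maxFn f₁ x ^ r x + maxFn f₂ x ^ r x) := by
        refine lintegral_mono fun x => ?_
        have h : maxFn f x ≤ maxFn f₁ x + maxFn f₂ x := by
          refine le_trans (maxFn_mono (fun y => ?_) x) (maxFn_add_le hm₁ x)
          exact (congrFun (Set.indicator_self_add_compl {x | 1 < f x} f) y).ge
        refine (ENNReal.rpow_le_rpow h (by linarith [har x])).trans ?_
        refine (ENNReal.rpow_add_le_mul_rpow_add_rpow _ _ (by linarith [har x])).trans ?_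
        gcongr
        · norm_num
        · linarith [hrR x]
    _ = 2 ^ R * ((∫⁻ x, maxFn f₁ x ^ r x) + ∫⁻ x, maxFn f₂ x ^ r x) := by
        rw [lintegral_const_mul' _ _ (by finiteness),
          lintegral_add_left ((measurable_maxFn f₁).pow hrm)]
    _ ≤ 2 ^ R * (K₁ + K₂) := by gcongr

theorem iSup_rpow_le_tsum (u : ℕ → ℝ≥0∞) {r : ℝ} (hr : 0 < r) :
    (⨆ k, u k) ^ r ≤ ∑' k, u k ^ r := by
  rw [← ENNReal.le_rpow_inv_iff hr]
  exact iSup_le fun k => (ENNReal.le_rpow_inv_iff hr).2 (ENNReal.le_tsum k)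

theorem tsum_quarter_rpow_le (u : ℕ → ℝ≥0∞) {r R : ℝ} (hr : 1 ≤ r) (hrR : r ≤ R) :
    (∑' k, 4⁻¹ ^ k * u k) ^ r ≤ 2 ^ R * ∑' k, 2⁻¹ ^ k * u k ^ r := by
  have hr0 : 0 ≤ r := by linarith
  have h1 : ∑' k, 4⁻¹ ^ k * u k ≤ 2 * ⨆ k, 2⁻¹ ^ k * u k := by
    calc ∑' k, 4⁻¹ ^ k * u k ≤ ∑' k, 2⁻¹ ^ k * ⨆ k, 2⁻¹ ^ k * u k := by
          refine ENNReal.tsum_le_tsum fun k => ?_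
          have : (4⁻¹ : ℝ≥0∞) = 2⁻¹ * 2⁻¹ := by
            rw [← ENNReal.mul_inv (by simp) (by simp)]; norm_num
          rw [this, mul_pow, mul_assoc]
          exact mul_le_mul_right (le_iSup (fun k => (2⁻¹ : ℝ≥0∞) ^ k * u k) k) _
      _ = 2 * ⨆ k, 2⁻¹ ^ k * u k := by
          rw [ENNReal.tsum_mul_right, ENNReal.tsum_geometric, ENNReal.one_sub_inv_two, inv_inv]
  calc (∑' k, 4⁻¹ ^ k * u k) ^ r ≤ (2 * ⨆ k, 2⁻¹ ^ k * u k) ^ r :=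
        ENNReal.rpow_le_rpow h1 hr0
    _ = 2 ^ r * (⨆ k, 2⁻¹ ^ k * u k) ^ r := ENNReal.mul_rpow_of_nonneg _ _ hr0
    _ ≤ 2 ^ R * ∑' k, (2⁻¹ ^ k * u k) ^ r := by
        gcongr
        · norm_num
        · exact iSup_rpow_le_tsum _ (by linarith)
    _ ≤ 2 ^ R * ∑' k, 2⁻¹ ^ k * u k ^ r := by
        refine mul_le_mul_right (ENNReal.tsum_le_tsum fun k => ?_) _
        rw [ENNReal.mul_rpow_of_nonneg _ _ hr0]
        gcongr
        refine (ENNReal.rpow_le_rpow_of_exponent_ge (pow_le_one' (by simp) k) hr).trans ?_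
        simp

/-- The Rubio de Francia algorithm: every `h` in the modular unit ball of `L^{r(·)}` has a
majorant `H`, with controlled modular, which satisfies a pointwise `A₁` condition. -/
theorem exists_rubioDeFrancia {r : Rn n → ℝ} {a R : ℝ} (ha : 1 < a)
    (har : ∀ x, a ≤ r x) (hrR : ∀ x, r x ≤ R) (hrm : Measurable r) (hr : LogHolder r) :
    ∃ A L : ℝ≥0∞, A ≠ ⊤ ∧ L ≠ ⊤ ∧ ∀ h : Rn n → ℝ≥0∞, Measurable h → ∫⁻ x, h x ^ r x ≤ 1 →
      ∃ H : Rn n → ℝ≥0∞, Measurable H ∧ (∀ x, h x ≤ H x) ∧ ∫⁻ x, H x ^ r x ≤ L ∧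
        ∀ x, maxFn H x ≤ A * H x := by
  obtain ⟨K, hK, hM⟩ := exists_modular_maxFn_le ha har hrR hrm hr
  set A := max K 1
  have hA : A ≠ ⊤ := by simp [A, hK]
  have hA1 : 1 ≤ A := le_max_right _ _
  have hA0 : A ≠ 0 := (zero_lt_one.trans_le hA1).ne'
  have hr1 : ∀ x, 1 ≤ r x := fun x => ha.le.trans (har x)
  refine ⟨4 * A, 2 ^ R * 2, by finiteness, by finiteness, fun h hh hint => ?_⟩
  set T : (Rn n → ℝ≥0∞) → Rn n → ℝ≥0∞ := fun f x => A⁻¹ * maxFn f x with hT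
  have hTu : ∀ k, Measurable (T^[k] h) ∧ ∫⁻ x, (T^[k] h) x ^ r x ≤ 1 := by
    intro k
    induction k with
    | zero => exact ⟨hh, hint⟩
    | succ k ih =>
      rw [Function.iterate_succ_apply']
      refine ⟨(measurable_maxFn _).const_mul _, ?_⟩
      calc ∫⁻ x, T (T^[k] h) x ^ r x ≤ ∫⁻ x, A⁻¹ * maxFn (T^[k] h) x ^ r x := by
            refine lintegral_mono fun x => ?_
            simp only [hT]
            rw [ENNReal.mul_rpow_of_nonneg _ _ (by linarith [hr1 x])]
            gcongr
            refine (ENNReal.rpow_le_rpow_of_exponent_ge (ENNReal.inv_le_one.2 hA1)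
              (hr1 x)).trans ?_
            simp
        _ = A⁻¹ * ∫⁻ x, maxFn (T^[k] h) x ^ r x :=
            lintegral_const_mul' _ _ (by simpa using hA0)
        _ ≤ A⁻¹ * A := by
            gcongr
            exact (hM _ ih.1 ih.2).trans (le_max_left _ _)
        _ = 1 := ENNReal.inv_mul_cancel hA0 hA
  have hm : ∀ k, Measurable fun x => 4⁻¹ ^ k * (T^[k] h) x := fun k => (hTu k).1.const_mul _
  refine ⟨fun x => ∑' k, 4⁻¹ ^ k * (T^[k] h) x, Measurable.tsum hm, fun x => ?_, ?_, fun x => ?_⟩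
  · simpa using ENNReal.le_tsum (f := fun k => 4⁻¹ ^ k * (T^[k] h) x) 0
  · calc ∫⁻ x, (∑' k, 4⁻¹ ^ k * (T^[k] h) x) ^ r x
        ≤ ∫⁻ x, 2 ^ R * ∑' k, 2⁻¹ ^ k * (T^[k] h) x ^ r x :=
          lintegral_mono fun x => tsum_quarter_rpow_le _ (hr1 x) (hrR x)
      _ = 2 ^ R * ∑' k, 2⁻¹ ^ k * ∫⁻ x, (T^[k] h) x ^ r x := by
          have : 0 ≤ R := by linarith [hr1 0, hrR 0]
          rw [lintegral_const_mul' _ _ (by finiteness),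
            lintegral_tsum fun k => (((hTu k).1.pow hrm).const_mul _).aemeasurable]
          congr 1
          refine tsum_congr fun k => lintegral_const_mul' _ _ (by finiteness)
      _ ≤ 2 ^ R * ∑' k, 2⁻¹ ^ k := by
          gcongr with k
          exact mul_le_of_le_one_right' (hTu k).2
      _ = 2 ^ R * 2 := by
          rw [ENNReal.tsum_geometric, ENNReal.one_sub_inv_two, inv_inv]
  · calc maxFn (fun x => ∑' k, 4⁻¹ ^ k * (T^[k] h) x) x
        ≤ ∑' k, maxFn (fun x => 4⁻¹ ^ k * (T^[k] h) x) x := maxFn_tsum_le hm x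
      _ ≤ ∑' k, 4 * A * (4⁻¹ ^ (k + 1) * (T^[k + 1] h) x) := by
          refine ENNReal.tsum_le_tsum fun k => (maxFn_const_mul_le (hTu k).1 _ x).trans ?_
          rw [Function.iterate_succ_apply']
          simp only [hT]
          refine le_of_eq ?_
          calc 4⁻¹ ^ k * maxFn (T^[k] h) x
              = (4 * 4⁻¹) * (A * A⁻¹) * (4⁻¹ ^ k * maxFn (T^[k] h) x) := by
                rw [ENNReal.mul_inv_cancel (by simp) (by simp), ENNReal.mul_inv_cancel hA0 hA]
                simp
            _ = _ := by rw [pow_succ]; ring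
      _ = 4 * A * ∑' k, 4⁻¹ ^ (k + 1) * (T^[k + 1] h) x := ENNReal.tsum_mul_left
      _ ≤ 4 * A * ∑' k, 4⁻¹ ^ k * (T^[k] h) x := by
          refine mul_le_mul_right ?_ _
          exact ENNReal.tsum_comp_le_tsum_of_injective (add_left_injective 1)
            fun k => 4⁻¹ ^ k * (T^[k] h) x

theorem measurableSet_stdCube (c : Rn n) (ρ : ℝ) : MeasurableSet (stdCube c ρ) := by
  have : stdCube c ρ = ⋂ i, {y : Rn n | |y i - c i| ≤ ρ} := by
    ext y; simp [stdCube]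
  rw [this]
  exact MeasurableSet.iInter fun i => measurableSet_le (by fun_prop) measurable_const

theorem ball_subset_stdCube (c : Rn n) (ρ : ℝ) : Metric.ball c ρ ⊆ stdCube c ρ := by
  intro y hy i
  rw [mem_ball_iff_norm] at hy
  exact (PiLp.norm_apply_le (y - c) i).trans hy.le

theorem stdCube_subset_ball {c x : Rn n} {ρ : ℝ} (hρ : 0 < ρ) (hx : x ∈ stdCube c ρ) :
    stdCube c ρ ⊆ Metric.ball x ((2 * n + 1) * ρ) := by
  intro y hy
  rw [mem_ball_iff_norm, EuclideanSpace.norm_eq]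
  refine Real.sqrt_lt_sqrt_iff (y := ((2 * n + 1) * ρ) ^ 2) (by positivity) |>.2 ?_ |>.trans_eq
    (Real.sqrt_sq (by positivity))
  calc ∑ i, ‖(y - x) i‖ ^ 2 ≤ ∑ _i : Fin n, (2 * ρ) ^ 2 := by
        refine Finset.sum_le_sum fun i _ => ?_
        gcongr
        have h1 := abs_le.1 (hx i)
        have h2 := abs_le.1 (hy i)
        simp only [PiLp.sub_apply, Real.norm_eq_abs]
        exact abs_le.2 ⟨by linarith, by linarith⟩
    _ = 4 * n * ρ ^ 2 := by simp; ring
    _ < ((2 * n + 1) * ρ) ^ 2 := by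
        have : 0 < ρ ^ 2 := by positivity
        nlinarith [mul_nonneg (sq_nonneg (n : ℝ)) this.le]

theorem volume_stdCube_ne_zero (c : Rn n) {ρ : ℝ} (hρ : 0 < ρ) : volume (stdCube c ρ) ≠ 0 :=
  ((Metric.measure_ball_pos volume c hρ).trans_le
    (measure_mono (ball_subset_stdCube c ρ))).ne'

theorem volume_stdCube_ne_top (c : Rn n) {ρ : ℝ} (hρ : 0 < ρ) : volume (stdCube c ρ) ≠ ⊤ :=
  ((measure_mono (stdCube_subset_ball hρ (x := c) fun i => by simpa using hρ.le)).trans_lt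
    measure_ball_lt_top).ne

theorem setLIntegral_stdCube_div_le (f : Rn n → ℝ≥0∞) {c x : Rn n} {ρ : ℝ} (hρ : 0 < ρ)
    (hx : x ∈ stdCube c ρ) :
    (∫⁻ y in stdCube c ρ, f y) / volume (stdCube c ρ)
      ≤ ENNReal.ofReal ((2 * n + 1) ^ n) * maxFn f x := by
  have hM : (0 : ℝ) < 2 * n + 1 := by positivity
  set B := Metric.ball x ((2 * n + 1) * ρ) with hB
  have hv : volume B = ENNReal.ofReal ((2 * n + 1) ^ n) * volume (Metric.ball c ρ) := by
    rw [hB, Measure.addHaar_ball_mul_of_pos _ _ hM, finrank_euclideanSpace_fin,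
      Measure.addHaar_ball_center volume c]
  have hM0 : ENNReal.ofReal ((2 * n + 1) ^ n) ≠ 0 := (ENNReal.ofReal_pos.2 (by positivity)).ne'
  calc (∫⁻ y in stdCube c ρ, f y) / volume (stdCube c ρ)
      ≤ (∫⁻ y in B, f y) / volume (Metric.ball c ρ) :=
        ENNReal.div_le_div (lintegral_mono_set (stdCube_subset_ball hρ hx))
          (measure_mono (ball_subset_stdCube c ρ))
    _ = ENNReal.ofReal ((2 * n + 1) ^ n) * ((∫⁻ y in B, f y) / volume B) := by
        rw [hv, ← mul_div_assoc, ENNReal.mul_div_mul_left _ _ hM0 ENNReal.ofReal_ne_top]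
    _ ≤ ENNReal.ofReal ((2 * n + 1) ^ n) * maxFn f x := by
        gcongr
        exact le_maxFn f (Metric.mem_ball_self (by positivity))

theorem ne_zero_of_maxFn_le {H : Rn n → ℝ≥0∞} {A : ℝ≥0∞} (hHm : Measurable H)
    (hH : ∀ x, maxFn H x ≤ A * H x) (h0 : ¬ H =ᵐ[volume] 0) (x : Rn n) : H x ≠ 0 := by
  intro hx
  apply h0
  have hM : maxFn H x = 0 := by simpa [hx] using hH x
  have hk : ∀ k : ℕ, ∀ᵐ y ∂volume.restrict (Metric.ball x k), H y = 0 := by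
    intro k
    rcases k.eq_zero_or_pos with rfl | hk
    · simp
    · have h := le_maxFn H (Metric.mem_ball_self (x := x) (Nat.cast_pos.2 hk : (0 : ℝ) < k))
      rw [hM, nonpos_iff_eq_zero, ENNReal.div_eq_zero_iff] at h
      exact (lintegral_eq_zero_iff hHm).1 (h.resolve_right measure_ball_lt_top.ne)
  have := (ae_restrict_iUnion_iff (fun k : ℕ => Metric.ball x k) (fun y => H y = 0)).2 hk
  rwa [Metric.iUnion_ball_nat, Measure.restrict_univ] at this

theorem cubeAvg_toReal_min_le {H : Rn n → ℝ≥0∞} {A : ℝ≥0∞} (hHm : Measurable H) (hA : A ≠ ⊤)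
    (hH : ∀ x, maxFn H x ≤ A * H x) (N : ℕ) {c x : Rn n} {ρ : ℝ} (hρ : 0 < ρ)
    (hx : x ∈ stdCube c ρ) :
    cubeAvg (stdCube c ρ) (fun y => (min (H y) N).toReal) ≤
      (ENNReal.ofReal ((2 * n + 1) ^ n) * A + 1).toReal * (min (H x) N).toReal := by
  have hN : ∀ y, min (H y) N ≠ ⊤ := fun y => (min_lt_of_right_lt (by simp)).ne
  have hvt := volume_stdCube_ne_top c hρ
  have hle : (∫⁻ y in stdCube c ρ, min (H y) N) / volume (stdCube c ρ) ≤
      (ENNReal.ofReal ((2 * n + 1) ^ n) * A + 1) * min (H x) N := by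
    rw [mul_min]
    refine le_min ?_ ?_
    · refine (setLIntegral_stdCube_div_le _ hρ hx).trans ?_
      rw [add_mul, mul_assoc]
      refine le_trans ?_ le_self_add
      gcongr
      exact (maxFn_mono (fun y => min_le_left _ _) x).trans (hH x)
    · refine le_trans ?_ (le_mul_of_one_le_left' le_add_self)
      refine ENNReal.div_le_of_le_mul ?_
      rw [← setLIntegral_const]
      exact lintegral_mono fun y => min_le_right _ _
  rw [cubeAvg, integral_toReal (hHm.min measurable_const).aemeasurable
    (ae_of_all _ fun y => (hN y).lt_top), mul_comm, ← div_eq_mul_inv, ← ENNReal.toReal_div,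
    ← ENNReal.toReal_mul]
  refine ENNReal.toReal_mono ?_ hle
  have := hN x
  finiteness

/-- Powers of truncated `A₁`-type majorants are weights with a uniform reverse Hölder constant. -/
theorem isWeight_and_RHWith {H : Rn n → ℝ≥0∞} {A : ℝ≥0∞} (hHm : Measurable H) (hA : A ≠ ⊤)
    (hH : ∀ x, maxFn H x ≤ A * H x) (hH0 : ∀ x, H x ≠ 0) {N : ℕ} (hN0 : N ≠ 0)
    {p q : ℝ} (hp : 0 < p) (hq : 0 < q) :
    IsWeight (fun x => (min (H x) N).toReal ^ (1 / q)) ∧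
    RHWith (fun x => ((min (H x) N).toReal ^ (1 / q)) ^ p) (q / p)
      ((ENNReal.ofReal ((2 * n + 1) ^ n) * A + 1).toReal ^ (p / q)) := by
  have hN : ∀ y, min (H y) N ≠ ⊤ := fun y => (min_lt_of_right_lt (by simp)).ne
  have hWN : ∀ y, (min (H y) (N : ℝ≥0∞)).toReal ≤ N := fun y => by
    simpa using ENNReal.toReal_mono (by simp) (min_le_right (H y) (N : ℝ≥0∞))
  have hWm : Measurable fun y => (min (H y) (N : ℝ≥0∞)).toReal :=
    (hHm.min measurable_const).ennreal_toReal
  have hW0 : ∀ y, 0 < (min (H y) (N : ℝ≥0∞)).toReal := fun y =>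
    ENNReal.toReal_pos (by simp [min_eq_iff, hH0 y, hN0]) (hN y)
  have hint : ∀ {t : ℝ}, 0 ≤ t → LocallyIntegrable
      (fun y => (min (H y) (N : ℝ≥0∞)).toReal ^ t) volume := fun {t} ht =>
    (locallyIntegrable_const ((N : ℝ) ^ t)).mono (hWm.pow_const _).aestronglyMeasurable
      (ae_of_all _ fun y => by
        rw [Real.norm_of_nonneg (by positivity), Real.norm_of_nonneg (by positivity)]
        exact Real.rpow_le_rpow (hW0 y).le (hWN y) ht)
  refine ⟨⟨hint (by positivity), fun x => by positivity, ae_of_all _ fun x =>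
    Real.rpow_pos_of_pos (hW0 x) _⟩, ?_⟩
  rintro Q ⟨c, ρ, hρ, rfl⟩
  have hexp : ∀ x, (((min (H x) (N : ℝ≥0∞)).toReal ^ (1 / q)) ^ p) ^ (q / p) =
      (min (H x) (N : ℝ≥0∞)).toReal := fun x => by
    rw [← Real.rpow_mul (hW0 x).le, ← Real.rpow_mul (hW0 x).le]
    convert Real.rpow_one _
    field_simp
  have hexp' : ∀ x, ((min (H x) (N : ℝ≥0∞)).toReal ^ (1 / q)) ^ p =
      (min (H x) (N : ℝ≥0∞)).toReal ^ (p / q) := fun x => by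
    rw [← Real.rpow_mul (hW0 x).le]
    congr 1
    ring
  simp_rw [hexp, hexp']
  rw [show 1 / (q / p) = p / q by field_simp]
  set m := (cubeAvg (stdCube c ρ) fun x => (min (H x) (N : ℝ≥0∞)).toReal) ^ (p / q)
  set D := (ENNReal.ofReal ((2 * n + 1) ^ n) * A + 1).toReal
  set v := (volume (stdCube c ρ)).toReal
  have hv : 0 < v := ENNReal.toReal_pos (volume_stdCube_ne_zero c hρ) (volume_stdCube_ne_top c hρ)
  have hm : ∀ x ∈ stdCube c ρ, m ≤ D ^ (p / q) * (min (H x) (N : ℝ≥0∞)).toReal ^ (p / q) := by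
    intro x hx
    rw [← Real.mul_rpow ENNReal.toReal_nonneg (hW0 x).le]
    refine Real.rpow_le_rpow ?_ (cubeAvg_toReal_min_le hHm hA hH N hρ hx) (by positivity)
    exact mul_nonneg (by positivity) (integral_nonneg fun y => (hW0 y).le)
  have hio : IntegrableOn (fun y => (min (H y) (N : ℝ≥0∞)).toReal ^ (p / q)) (stdCube c ρ) := by
    refine ((hint (by positivity)).integrableOn_isCompact
      (isCompact_closedBall c ((2 * n + 1) * ρ))).mono_set ?_
    exact (stdCube_subset_ball hρ fun i => by simpa using hρ.le).trans Metric.ball_subset_closedBall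
  have h := setIntegral_mono_on (integrableOn_const (volume_stdCube_ne_top c hρ))
    (hio.const_mul (D ^ (p / q))) (measurableSet_stdCube c ρ) hm
  rw [setIntegral_const, integral_const_mul, smul_eq_mul, measureReal_def] at h
  rw [cubeAvg, mul_left_comm, ← div_eq_inv_mul, le_div_iff₀ hv, mul_comm]
  exact h

theorem LogHolder.continuous {r : Rn n → ℝ} (hr : LogHolder r) : Continuous r := by
  obtain ⟨⟨C, hC, h⟩, -⟩ := hr
  refine Metric.continuous_iff.2 fun y ε hε =>
    ⟨min (1 / 2) (Real.exp (-(C / ε))), by positivity, fun x hx => ?_⟩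
  rw [dist_eq_norm] at hx
  rw [Real.dist_eq]
  rcases (norm_nonneg (x - y)).eq_or_lt with h0 | h0
  · rw [sub_eq_zero.1 (norm_eq_zero.1 h0.symm)]
    simpa using hε
  refine (h x y h0 (hx.trans_le (min_le_left _ _))).trans_lt ?_
  have hl : C / ε < -Real.log ‖x - y‖ := by
    have := (Real.log_lt_iff_lt_exp h0).2 (hx.trans_le (min_le_right _ _))
    linarith
  have hl0 : 0 < -Real.log ‖x - y‖ := lt_trans (by positivity) hl
  rw [div_lt_iff₀ hε] at hl
  rw [div_lt_iff₀ hl0]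
  linarith

/-- A smooth monotone change of the exponent preserves log-Hölder continuity. -/
theorem LogHolder.div_sub {r : Rn n → ℝ} (hr : LogHolder r) {p b k : ℝ} (hp : 0 < p)
    (hk : 0 < k) (hpb : p < b) (hb : ∀ x, b ≤ r x) :
    LogHolder fun x => k * r x / (r x - p) := by
  have key : ∀ {s t : ℝ}, b ≤ s → b ≤ t →
      |k * s / (s - p) - k * t / (t - p)| ≤ k * p / (b - p) ^ 2 * |s - t| := by
    intro s t hs ht
    have hs0 : 0 < s - p := by linarith
    have ht0 : 0 < t - p := by linarith
    have hb0 : 0 < b - p := by linarith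
    have : k * s / (s - p) - k * t / (t - p) = k * p / ((s - p) * (t - p)) * (t - s) := by
      field_simp
      ring
    rw [this, abs_mul, abs_of_pos (by positivity), abs_sub_comm]
    gcongr
    nlinarith
  have hb0 : 0 < b - p := by linarith
  obtain ⟨s, D, hs, hD⟩ := hr.exists_limit hb
  obtain ⟨⟨C, hC, h⟩, -⟩ := hr
  refine ⟨⟨k * p / (b - p) ^ 2 * C, by positivity, fun x y h0 h1 => ?_⟩,
    k * s / (s - p), k * p / (b - p) ^ 2 * max D 1, by positivity, fun x => ?_⟩
  · rw [mul_div_assoc _ C]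
    exact (key (hb x) (hb y)).trans (by gcongr; exact h x y h0 h1)
  · have hlog : 0 < Real.log (Real.exp 1 + ‖x‖) := Real.log_pos (by
      linarith [Real.exp_one_gt_two, norm_nonneg x])
    rw [mul_div_assoc _ (max D 1)]
    refine (key (hb x) hs).trans ?_
    gcongr
    exact (hD x).trans (by gcongr; exact le_max_left _ _)

theorem LogHolder.exists_bounds {r : Rn n → ℝ} (hr : LogHolder r) (hr0 : ∀ x, 0 < r x) {p s : ℝ}
    (hp : p < essInf r (volume : Measure (Rn n)))
    (hb : ∃ B : ℝ, ∀ᵐ x ∂(volume : Measure (Rn n)), r x ≤ B)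
    (hs : essSup r (volume : Measure (Rn n)) < s) :
    ∃ a b : ℝ, p < a ∧ b < s ∧ ∀ x, a ≤ r x ∧ r x ≤ b := by
  obtain ⟨a, hpa, ha⟩ := exists_between hp
  obtain ⟨b, hb', hbs⟩ := exists_between hs
  obtain ⟨B, hB⟩ := hb
  have h1 : ∀ᵐ x ∂(volume : Measure (Rn n)), a < r x :=
    ae_lt_of_lt_essInf ha ⟨0, eventually_map.2 (ae_of_all _ fun x => (hr0 x).le)⟩
  have h2 : ∀ᵐ x ∂(volume : Measure (Rn n)), r x < b :=
    ae_lt_of_essSup_lt hb' ⟨B, eventually_map.2 hB⟩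
  have hcl : IsClosed {x | a ≤ r x ∧ r x ≤ b} :=
    (isClosed_le continuous_const hr.continuous).inter (isClosed_le hr.continuous continuous_const)
  have hd : Dense {x | a ≤ r x ∧ r x ≤ b} :=
    Measure.dense_of_ae (by filter_upwards [h1, h2] with x hx hx' using ⟨hx.le, hx'.le⟩)
  refine ⟨a, b, hpa, hbs, fun x => ?_⟩
  have : x ∈ {x | a ≤ r x ∧ r x ≤ b} := by
    rw [← hcl.closure_eq]
    exact hd x
  exact this

theorem mul_le_rpow_add_rpow (a b : ℝ≥0∞) {s t : ℝ} (h : s.HolderConjugate t) :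
    a * b ≤ a ^ s + b ^ t := by
  refine (ENNReal.young_inequality a b h).trans (add_le_add ?_ ?_)
  · exact ENNReal.div_le_of_le_mul (le_mul_of_one_le_right' (by simpa using h.lt.le))
  · exact ENNReal.div_le_of_le_mul (le_mul_of_one_le_right' (by simpa using h.symm.lt.le))

theorem lintegral_mul_le_of_forall_min {u H : Rn n → ℝ≥0∞} (hu : Measurable u)
    (hH : Measurable H) {B : ℝ≥0∞}
    (h : ∀ N : ℕ, N ≠ 0 → ∫⁻ x, u x * min (H x) N ≤ B) : ∫⁻ x, u x * H x ≤ B := by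
  have hmono : Monotone fun (N : ℕ) x => u x * min (H x) (N : ℝ≥0∞) := fun N M hNM x => by
    dsimp only
    gcongr
  have hsup : ∀ x, u x * H x = ⨆ N : ℕ, u x * min (H x) (N : ℝ≥0∞) := fun x => by
    rw [← ENNReal.mul_iSup, ← inf_iSup_eq, ENNReal.iSup_natCast, inf_top_eq]
  simp_rw [hsup]
  rw [lintegral_iSup (f := fun (N : ℕ) x => u x * min (H x) (N : ℝ≥0∞))
    (fun N => hu.mul (hH.min measurable_const)) hmono]
  exact iSup_le fun N => (lintegral_mono (hmono N.le_succ)).trans (h (N + 1) N.succ_ne_zero)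

/-- Data extracted from `‖f‖_{L^{q(·)}}` being positive and finite: a scale `l` comparable to
the norm at which the modular is at most `1` but not small. -/
theorem exists_scale {qv : Rn n → ℝ} {Q : ℝ} (hq0 : ∀ x, 0 ≤ qv x) (hQ : ∀ x, qv x ≤ Q)
    {f : Rn n → ℝ≥0∞} (h0 : varLpE qv f ≠ 0) (ht : varLpE qv f ≠ ⊤) :
    ∃ l : ℝ≥0∞, l ≠ 0 ∧ l ≠ ⊤ ∧ varLpE qv f ≤ l ∧ ∫⁻ x, (f x / l) ^ qv x ≤ 1 ∧
      1 ≤ 4 ^ Q * ∫⁻ x, (f x / l) ^ qv x := by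
  have hlt : varLpE qv f < 2 * varLpE qv f := by
    rw [two_mul]
    exact ENNReal.lt_add_right ht h0
  obtain ⟨l, hl, hl2⟩ := sInf_lt_iff.1 hlt
  have hlt' : l ≠ ⊤ := (hl2.trans (by finiteness)).ne
  refine ⟨l, hl.1.ne', hlt', sInf_le hl, hl.2, ?_⟩
  by_contra! hcon
  have hmem : ∫⁻ x, (f x / (4⁻¹ * l)) ^ qv x ≤ 1 := by
    refine le_trans ?_ hcon.le
    have hQ0 : 0 ≤ Q := (hq0 0).trans (hQ 0)
    rw [← lintegral_const_mul' _ _ (by finiteness)]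
    refine lintegral_mono fun x => ?_
    have : f x / (4⁻¹ * l) = 4 * (f x / l) := by
      rw [div_eq_mul_inv, ENNReal.mul_inv (by simp) (by simp), inv_inv, div_eq_mul_inv]
      ring
    rw [this, ENNReal.mul_rpow_of_nonneg _ _ (hq0 x)]
    gcongr
    · norm_num
    · exact hQ x
  have h1 : varLpE qv f ≤ 4⁻¹ * l := sInf_le ⟨by simpa [pos_iff_ne_zero] using hl.1.ne', hmem⟩
  have h2 : varLpE qv f ≤ 2⁻¹ * varLpE qv f := by
    calc varLpE qv f ≤ 4⁻¹ * l := h1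
      _ ≤ 4⁻¹ * (2 * varLpE qv f) := by gcongr
      _ = 2⁻¹ * varLpE qv f := by
        rw [← mul_assoc]
        congr 1
        rw [show (4 : ℝ≥0∞) = 2 * 2 by norm_num, ENNReal.mul_inv (by simp) (by simp), mul_assoc,
          ENNReal.inv_mul_cancel (by simp) (by simp), mul_one]
  rw [mul_comm, ← div_eq_mul_inv] at h2
  exact h2.not_gt (ENNReal.half_lt_self h0 ht)

/-- Pointwise relations between the exponents `p < a ≤ t ≤ b < (1/p - 1/q)⁻¹`, `u` given by
`1/t - 1/u = 1/p - 1/q`, and the exponent `(p/q) t/(t - p)`, conjugate to `u/q`. -/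
theorem exponent_relations {p q a b t u : ℝ} (hp : 0 < p) (hpq : p < q) (hpa : p < a)
    (hbs : b < (1 / p - 1 / q)⁻¹) (hat : a ≤ t) (htb : t ≤ b)
    (h : 1 / t - 1 / u = 1 / p - 1 / q) :
    q < u ∧ u ≤ (1 / b - (1 / p - 1 / q))⁻¹ ∧
      1 < p / q * b / (b - p) ∧ p / q * b / (b - p) ≤ p / q * t / (t - p) ∧
      p / q * t / (t - p) ≤ p / q * a / (a - p) ∧
      (u - q) * (p / q * t / (t - p)) = u := by
  have hq : 0 < q := hp.trans hpq
  have ht0 : 0 < t := by linarith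
  have hb0 : 0 < b := by linarith
  have hs : 0 < 1 / p - 1 / q := sub_pos.2 (one_div_lt_one_div_of_lt hp hpq)
  have hb1 : 1 / p - 1 / q < 1 / b := by
    rw [one_div b]
    exact (lt_inv_comm₀ hb0 hs).1 hbs
  have htb1 : 1 / b ≤ 1 / t := one_div_le_one_div_of_le ht0 htb
  have hpt1 : 1 / t < 1 / p := one_div_lt_one_div_of_lt hp (by linarith)
  have hu1 : 0 < 1 / u := by linarith
  have hu : 0 < u := one_div_pos.1 hu1
  have hqu : q < u := lt_of_one_div_lt_one_div hu (by linarith)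
  have htp : 0 < t - p := by linarith
  have hap : 0 < a - p := by linarith
  have hbp : 0 < b - p := by linarith
  refine ⟨hqu, ?_, ?_, ?_, ?_, ?_⟩
  · rw [le_inv_comm₀ hu (by linarith), ← one_div]
    linarith
  · rw [one_lt_div hbp]
    field_simp at hb1 ⊢
    nlinarith
  · rw [div_le_div_iff₀ hbp htp]
    have : 0 ≤ p / q * p := by positivity
    nlinarith
  · rw [div_le_div_iff₀ htp hap]
    have : 0 ≤ p / q * p := by positivity
    nlinarith
  · field_simp at h ⊢
    nlinarith

/-- The extrapolation estimate for one pair of functions, at fixed scales `l` and `μ`. -/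
theorem extrapolation_scale_le {p q : ℝ} (hp : 0 < p) (hpq : p < q) {A L C : ℝ≥0∞}
    (hA : A ≠ ⊤) (hL : L ≠ ⊤) {f g : Rn n → ℝ} (hf : Measurable f)
    (hyp : ∀ w : Rn n → ℝ, IsWeight w →
      RHWith (fun x => w x ^ p) (q / p)
        ((ENNReal.ofReal ((2 * n + 1) ^ n) * A + 1).toReal ^ (p / q)) →
      weightedLp q (fun x => w x ^ q) f < ⊤ →
        weightedLp q (fun x => w x ^ q) f ≤ C * weightedLp p (fun x => w x ^ p) g)
    {pv qv r : Rn n → ℝ} {Q : ℝ} (hpv : ∀ x, p < pv x) (hpvm : Measurable pv)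
    (hqv : ∀ x, q < qv x) (hqvm : Measurable qv)
    (hr : ∀ x, r x = p / q * pv x / (pv x - p)) (hqr : ∀ x, (qv x - q) * r x = qv x)
    (hr1 : ∀ x, 1 < r x)
    (hRdF : ∀ h : Rn n → ℝ≥0∞, Measurable h → ∫⁻ x, h x ^ r x ≤ 1 →
      ∃ H : Rn n → ℝ≥0∞, Measurable H ∧ (∀ x, h x ≤ H x) ∧ ∫⁻ x, H x ^ r x ≤ L ∧
        ∀ x, maxFn H x ≤ A * H x)
    {l μ : ℝ≥0∞} (hl0 : l ≠ 0) (hlt : l ≠ ⊤) (hμ0 : μ ≠ 0) (hμt : μ ≠ ⊤)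
    (hfl : ∫⁻ x, (ENNReal.ofReal |f x| / l) ^ qv x ≤ 1)
    (hfQ : 1 ≤ 4 ^ Q * ∫⁻ x, (ENNReal.ofReal |f x| / l) ^ qv x)
    (hgμ : ∫⁻ x, (ENNReal.ofReal |g x| / μ) ^ pv x ≤ 1) :
    l ≤ 4 ^ (Q / q) * C * (1 + L) ^ (1 / p) * μ := by
  have hq : 0 < q := hp.trans hpq
  set φ : Rn n → ℝ≥0∞ := fun x => ENNReal.ofReal |f x| / l with hφ
  have hφm : Measurable φ := by fun_prop
  have hφf : ∀ x, ENNReal.ofReal |f x| = l * φ x := fun x =>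
    (ENNReal.mul_div_cancel hl0 hlt).symm
  set γ : Rn n → ℝ≥0∞ := fun x => ENNReal.ofReal |g x| / μ with hγ
  have hγg : ∀ x, ENNReal.ofReal |g x| = μ * γ x := fun x =>
    (ENNReal.mul_div_cancel hμ0 hμt).symm
  have hhr : ∀ x, (φ x ^ (qv x - q)) ^ r x = φ x ^ qv x := fun x => by
    rw [← ENNReal.rpow_mul, hqr]
  obtain ⟨H, hHm, hhH, hHL, hHA⟩ := hRdF (fun x => φ x ^ (qv x - q))
    (hφm.pow (hqvm.sub_const q)) (by simpa only [hhr] using hfl)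
  have hprod : ∀ x, φ x ^ qv x ≤ φ x ^ q * H x := fun x => by
    calc φ x ^ qv x = φ x ^ q * φ x ^ (qv x - q) := by
          rw [← ENNReal.rpow_add_of_nonneg _ _ hq.le (by linarith [hqv x])]
          congr 1
          ring
      _ ≤ φ x ^ q * H x := by gcongr; exact hhH x
  have hH0 : ∀ x, H x ≠ 0 := by
    refine ne_zero_of_maxFn_le hHm hHA fun h0 => ?_
    have : ∫⁻ x, φ x ^ qv x = 0 := by
      rw [lintegral_eq_zero_iff (hφm.pow hqvm)]
      filter_upwards [h0] with x hx
      simpa [hx] using hprod x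
    rw [this] at hfQ
    simp at hfQ
  have hfin : ∫⁻ x, φ x ^ q * H x ≤ 1 + L := by
    calc ∫⁻ x, φ x ^ q * H x ≤ ∫⁻ x, (φ x ^ qv x + H x ^ r x) := by
          refine lintegral_mono fun x => ?_
          have hc : (qv x / q).HolderConjugate (r x) := by
            have h1 := hqv x
            have h2 := hqr x
            have h3 := hr1 x
            refine Real.holderConjugate_iff.2 ⟨(one_lt_div hq).2 h1, ?_⟩
            have h4 : 0 < qv x := by linarith
            have h5 : 0 < r x := by linarith
            field_simp
            linarith
          refine (mul_le_rpow_add_rpow _ _ hc).trans_eq ?_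
          rw [← ENNReal.rpow_mul, mul_div_cancel₀ _ hq.ne']
      _ = (∫⁻ x, φ x ^ qv x) + ∫⁻ x, H x ^ r x := lintegral_add_left (hφm.pow hqvm) _
      _ ≤ 1 + L := add_le_add hfl hHL
  set B := C * μ * (1 + L) ^ (1 / p) / l with hB
  have hmain : ∫⁻ x, φ x ^ q * H x ≤ B ^ q := by
    refine lintegral_mul_le_of_forall_min (hφm.pow_const q) hHm fun N hN => ?_
    have hN' : ∀ y, min (H y) N ≠ ⊤ := fun y => (min_lt_of_right_lt (by simp)).ne
    obtain ⟨hw, hRH⟩ := isWeight_and_RHWith hHm hA hHA hH0 hN hp hq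
    have hwt : ∀ {t : ℝ}, 0 ≤ t → ∀ x,
        ENNReal.ofReal (((min (H x) (N : ℝ≥0∞)).toReal ^ (1 / q)) ^ t) =
          min (H x) N ^ (t / q) := fun {t} ht x => by
      rw [← Real.rpow_mul ENNReal.toReal_nonneg,
        ← ENNReal.ofReal_rpow_of_nonneg ENNReal.toReal_nonneg (by positivity),
        ENNReal.ofReal_toReal (hN' x)]
      congr 1
      ring
    have hX : weightedLp q (fun x => ((min (H x) (N : ℝ≥0∞)).toReal ^ (1 / q)) ^ q) f =
        l * (∫⁻ x, φ x ^ q * min (H x) N) ^ (1 / q) := by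
      simp only [weightedLp, hwt hq.le, div_self hq.ne', ENNReal.rpow_one, hφf,
        ENNReal.mul_rpow_of_nonneg _ _ hq.le, mul_assoc]
      rw [lintegral_const_mul' _ _ (by finiteness),
        ENNReal.mul_rpow_of_nonneg _ _ (by positivity), ← ENNReal.rpow_mul,
        mul_one_div_cancel hq.ne', ENNReal.rpow_one]
    have hY : weightedLp p (fun x => ((min (H x) (N : ℝ≥0∞)).toReal ^ (1 / q)) ^ p) g ≤
        μ * (1 + L) ^ (1 / p) := by
      simp only [weightedLp, hwt hp.le, hγg, ENNReal.mul_rpow_of_nonneg _ _ hp.le, mul_assoc]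
      rw [lintegral_const_mul' _ _ (by finiteness),
        ENNReal.mul_rpow_of_nonneg _ _ (by positivity), ← ENNReal.rpow_mul,
        mul_one_div_cancel hp.ne', ENNReal.rpow_one]
      gcongr
      calc ∫⁻ x, γ x ^ p * min (H x) N ^ (p / q) ≤ ∫⁻ x, (γ x ^ pv x + H x ^ r x) := by
            refine lintegral_mono fun x => ?_
            have h1 := hpv x
            have h2 : 0 < pv x - p := by linarith
            have h3 : 0 < pv x := by linarith
            have hc : (pv x / p).HolderConjugate (pv x / (pv x - p)) := by
              refine Real.holderConjugate_iff.2 ⟨(one_lt_div hp).2 h1, ?_⟩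
              field_simp
              ring
            calc γ x ^ p * min (H x) N ^ (p / q) ≤ γ x ^ p * H x ^ (p / q) := by
                  gcongr
                  exact min_le_left _ _
              _ ≤ _ := mul_le_rpow_add_rpow _ _ hc
              _ = γ x ^ pv x + H x ^ r x := by
                  rw [← ENNReal.rpow_mul, ← ENNReal.rpow_mul, mul_div_cancel₀ _ hp.ne', hr,
                    mul_div_assoc]
        _ = (∫⁻ x, γ x ^ pv x) + ∫⁻ x, H x ^ r x :=
            lintegral_add_right _ (hHm.pow (by
              rw [show r = _ from funext hr]
              fun_prop))
        _ ≤ 1 + L := add_le_add hgμ hHL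
    have hXt : ∫⁻ x, φ x ^ q * min (H x) N ≠ ⊤ := by
      refine ne_top_of_le_ne_top (by finiteness) ((lintegral_mono fun x => ?_).trans hfin)
      gcongr
      exact min_le_left _ _
    have h := hyp _ hw hRH (by rw [hX]; exact (by finiteness : _ ≠ ⊤).lt_top)
    rw [hX] at h
    have h' := h.trans (mul_le_mul_right hY C)
    rw [← ENNReal.rpow_inv_le_iff hq, ← one_div, hB,
      ENNReal.le_div_iff_mul_le (Or.inl hl0) (Or.inl hlt), mul_comm, mul_assoc]
    exact h'
  have h1 : 1 ≤ (4 ^ (Q / q) * B) ^ q := by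
    rw [ENNReal.mul_rpow_of_nonneg _ _ hq.le, ← ENNReal.rpow_mul, div_mul_cancel₀ _ hq.ne']
    refine hfQ.trans (mul_le_mul_right ((lintegral_mono hprod).trans hmain) _)
  have h2 : 1 ≤ 4 ^ (Q / q) * B := by
    by_contra! h
    exact h1.not_gt (ENNReal.rpow_lt_one h hq)
  rw [hB, ← mul_div_assoc, ENNReal.le_div_iff_mul_le (Or.inl hl0) (Or.inl hlt), one_mul] at h2
  exact h2.trans_eq (by ring)

/-- (Off-diagonal extrapolation from reverse Hölder weights into
variable Lebesgue spaces.)  Let `0 < p < q < ∞`.  If for every weight `w` with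
`w^p ∈ RH_{q/p}` one has `‖f‖_{L^q(w^q)} ≤ C ‖g‖_{L^p(w^p)}` for `(f,g) ∈ ℱ`, with `C`
depending only on the reverse Hölder constant of `w^p`, then for every `p(·) ∈ LH` with
`p < p_- ≤ p_+ < (1/p - 1/q)⁻¹` one has `‖f‖_{L^{q(·)}} ≤ C' ‖g‖_{L^{p(·)}}` for
`(f,g) ∈ ℱ`, where `1/p(·) - 1/q(·) = 1/p - 1/q`. -/
theorem stmt9_offdiagonal_rh_extrapolation_variable (n : ℕ) (p q : ℝ)
    (hp : 0 < p) (hpq : p < q)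
    (F : Set ((Rn n → ℝ) × (Rn n → ℝ)))
    (hF : ∀ fg ∈ F, Measurable fg.1 ∧ Measurable fg.2 ∧
      (∀ x, 0 ≤ fg.1 x) ∧ (∀ x, 0 ≤ fg.2 x))
    (hyp : ∀ Kc : ℝ, 0 < Kc → ∃ C : ℝ, 0 < C ∧ ∀ w : Rn n → ℝ, IsWeight w →
      RHWith (fun x => w x ^ p) (q / p) Kc →
      ∀ fg ∈ F, weightedLp q (fun x => w x ^ q) fg.1 < ⊤ →
        weightedLp q (fun x => w x ^ q) fg.1 ≤
          ENNReal.ofReal C * weightedLp p (fun x => w x ^ p) fg.2)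
    (pv qv : Rn n → ℝ) (hpv : ExponentP0 pv) (hLH : LogHolder pv)
    (hpm : p < essInf pv (volume : Measure (Rn n)))
    (hpb : ∃ B : ℝ, ∀ᵐ x ∂(volume : Measure (Rn n)), pv x ≤ B)
    (hpp : essSup pv (volume : Measure (Rn n)) < (1 / p - 1 / q)⁻¹)
    (hqv : ∀ x, 1 / pv x - 1 / qv x = 1 / p - 1 / q) :
    ∃ C' : ℝ, 0 < C' ∧ ∀ fg ∈ F, varLp qv fg.1 < ⊤ →
      varLp qv fg.1 ≤ ENNReal.ofReal C' * varLp pv fg.2 := by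
  have hq : 0 < q := hp.trans hpq
  obtain ⟨a, b, hpa, hbs, hab⟩ := hLH.exists_bounds hpv.2 hpm hpb hpp
  have hex := fun x => exponent_relations hp hpq hpa hbs (hab x).1 (hab x).2 (hqv x)
  set Q := (1 / b - (1 / p - 1 / q))⁻¹
  have hpv1 : ∀ x, p < pv x := fun x => hpa.trans_le (hab x).1
  have hpvm : Measurable pv := hpv.1
  have hqvm : Measurable qv := by
    have : qv = fun x => (1 / pv x - (1 / p - 1 / q))⁻¹ := by
      funext x
      rw [← hqv x, sub_sub_self, one_div, inv_inv]
    rw [this]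
    fun_prop
  obtain ⟨A, L, hA, hL, hRdF⟩ := exists_rubioDeFrancia (r := fun x => p / q * pv x / (pv x - p))
    (hex 0).2.2.1 (fun x => (hex x).2.2.2.1) (fun x => (hex x).2.2.2.2.1) (by fun_prop)
    (hLH.div_sub hp (div_pos hp hq) hpa fun x => (hab x).1)
  have hD : 0 < (ENNReal.ofReal ((2 * n + 1) ^ n) * A + 1).toReal :=
    ENNReal.toReal_pos (by simp) (by finiteness)
  obtain ⟨C, hC, hw⟩ := hyp _ (Real.rpow_pos_of_pos hD (p / q))
  have hQ0 : 0 < Q := hq.trans ((hex 0).1.trans_le (hex 0).2.1)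
  set E : ℝ≥0∞ := 4 ^ (Q / q) * ENNReal.ofReal C * (1 + L) ^ (1 / p)
  have hEt : E ≠ ⊤ := by
    have : 0 ≤ Q / q := by positivity
    finiteness
  have hE0 : E ≠ 0 := by
    have h1 : ENNReal.ofReal C ≠ 0 := (ENNReal.ofReal_pos.2 hC).ne'
    have h2 : (4 : ℝ≥0∞) ^ (Q / q) ≠ 0 := (ENNReal.rpow_pos (by simp) (by simp)).ne'
    have h3 : (1 + L) ^ (1 / p) ≠ 0 := (ENNReal.rpow_pos (by simp) (by finiteness)).ne'
    exact mul_ne_zero (mul_ne_zero h2 h1) h3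
  refine ⟨E.toReal, ENNReal.toReal_pos hE0 hEt, fun fg hfg hfin => ?_⟩
  rw [ENNReal.ofReal_toReal hEt, mul_comm E, ← ENNReal.div_le_iff_le_mul (Or.inl hE0) (Or.inl hEt)]
  refine le_sInf fun μ hμ => ?_
  rw [ENNReal.div_le_iff_le_mul (Or.inl hE0) (Or.inl hEt), mul_comm]
  rcases eq_or_ne (varLp qv fg.1) 0 with h0 | h0
  · simp [h0]
  rcases eq_or_ne μ ⊤ with rfl | hμt
  · simp [ENNReal.mul_top, hE0]
  obtain ⟨l, hl0, hlt, hle, hl1, hlQ⟩ := exists_scale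
    (fun x => (hq.trans (hex x).1).le) (fun x => (hex x).2.1) h0 hfin.ne
  exact hle.trans (extrapolation_scale_le hp hpq hA hL (hF fg hfg).1
    (fun w hw₁ hw₂ => hw w hw₁ hw₂ fg hfg) hpv1 hpvm (fun x => (hex x).1) hqvm
    (fun _ => rfl) (fun x => (hex x).2.2.2.2.2)
    (fun x => (hex x).2.2.1.trans_le (hex x).2.2.2.1) hRdF hl0 hlt hμ.1.ne' hμt hl1 hlQ hμ.2)
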